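/- Let R be a Cohen–Macaulay local ring with dim R ≥ 1. Assume that for every height one prime ideal p of R the local ring R_p is Gorenstein and e(R_p) ≤ 6. Let I be a faithful ideal of R. If I ⊗_R Hom_R(I, R) is a reflexive R-module, then I is a principal ideal. -/

import Mathlib

open CategoryTheory TensorProduct

noncomputable section

/-- Minimal number of generators of a submodule. -/
def minGen (R : Type*) {M : Type*} [Semiring R] [AddCommMonoid M] [Module R M]
    (p : Submodule R M) : ℕ :=
  sInf {n | ∃ s : Finset M, s.card = n ∧ Submodule.span R (s : Set M) = p}

/-- Length of a module, as the height of `⊤` in its lattice of submodules. -/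
def moduleLength (R M : Type*) [Ring R] [AddCommGroup M] [Module R M] : ℕ∞ :=
  Order.height (⊤ : Submodule R M)

/-- `e` is the (Hilbert–Samuel) multiplicity of the one-dimensional local ring `(R, m)`:
the first difference of the Hilbert–Samuel function `n ↦ ℓ_R(R/mⁿ)` is eventually
equal to `e`. -/
def IsMultiplicityAt (R : Type*) [CommRing R] (m : Ideal R) (e : ℕ) : Prop :=
  ∃ N : ℕ, ∀ n ≥ N,
    moduleLength R (R ⧸ (m ^ (n + 1))) = moduleLength R (R ⧸ (m ^ n)) + e

/-- The `i`-th Ext module `Ext_R^i(M, N)`. -/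
def extMod (R : Type u) [CommRing R] (M N : ModuleCat.{u} R) (i : ℕ) : ModuleCat R :=
  ((Ext R (ModuleCat.{u} R) i).obj (Opposite.op M)).obj N

/-- `K` is a canonical module of the one-dimensional Cohen–Macaulay local ring `R` with
maximal ideal `m`, via the Bass-number characterization:
`Ext^i(R/m, K) = 0` for `i ≠ 1` and `Ext^1(R/m, K) ≅ R/m`. -/
def IsCanonicalModuleAt (R : Type u) [CommRing R] (m : Ideal R)
    (K : Type u) [AddCommGroup K] [Module R K] : Prop :=
  Module.Finite R K ∧
  (∀ i : ℕ, i ≠ 1 →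
    Subsingleton (extMod R (ModuleCat.of R (R ⧸ m)) (ModuleCat.of R K) i)) ∧
  Nonempty ((extMod R (ModuleCat.of R (R ⧸ m)) (ModuleCat.of R K) 1) ≅
    ModuleCat.of R (R ⧸ m))

/-- The evaluation map `I ⊗_R Hom_R(I, K) → K`, `x ⊗ f ↦ f x`. -/
def evalMap (R : Type*) [CommRing R] {M : Type*} [AddCommGroup M] [Module R M]
    (I : Submodule R M) (K : Type*) [AddCommGroup K] [Module R K] :
    (I ⊗[R] (I →ₗ[R] K)) →ₗ[R] K :=
  TensorProduct.lift LinearMap.applyₗ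

/-- A fractional ideal `I` of `R` with `FI = F`: a finitely generated `R`-submodule of the
total ring of fractions `F = Q(R)` containing a unit of `F`. -/
def IsFracIdealUnit (R : Type*) [CommRing R] (I : Submodule R (FractionRing R)) : Prop :=
  I.FG ∧ ∃ x ∈ I, IsUnit x

/-- A one-dimensional Cohen–Macaulay local ring: Noetherian, local, Krull dimension one,
and the maximal ideal contains a nonzerodivisor. -/
def IsOneDimCMLocal (R : Type*) [CommRing R] [IsLocalRing R] : Prop :=
  IsNoetherianRing R ∧ ringKrullDim R = 1 ∧
    ∃ x ∈ IsLocalRing.maximalIdeal R, x ∈ nonZeroDivisors R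

/-- The colon `M : N = {x ∈ A | x N ⊆ M}` of two `R`-submodules of an `R`-algebra `A`,
as an `R`-submodule of `A`. -/
def colonSub {R A : Type*} [CommRing R] [CommRing A] [Algebra R A]
    (M N : Submodule R A) : Submodule R A where
  carrier := {x : A | ∀ y ∈ N, x * y ∈ M}
  add_mem' := fun {a b} ha hb y hy => by
    rw [add_mul]; exact M.add_mem (ha y hy) (hb y hy)
  zero_mem' := fun y hy => by rw [zero_mul]; exact M.zero_mem
  smul_mem' := fun c {x} hx y hy => by
    rw [smul_mul_assoc]; exact M.smul_mem c (hx y hy)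


/-- `R` is a Cohen–Macaulay local ring: its depth (measured by vanishing of
`Ext^i(R/m, R)` below the Krull dimension) equals its Krull dimension. -/
def IsCMLocal (R : Type u) [CommRing R] [IsLocalRing R] : Prop :=
  ∃ d : ℕ, ringKrullDim R = d ∧ ∀ i : ℕ, i < d →
    Subsingleton (extMod R (ModuleCat.of R (R ⧸ IsLocalRing.maximalIdeal R))
      (ModuleCat.of R R) i)

section Colength

variable {R : Type*} [CommRing R] {F : Type*} [AddCommGroup F] [Module R F]

/-- The length of the quotient by a submodule. -/
def colength (U : Submodule R F) : ℕ∞ := Module.length R (F ⧸ U)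

lemma colength_top : colength (⊤ : Submodule R F) = 0 := by
  unfold colength
  rw [Module.length_eq_zero_iff]
  exact Submodule.Quotient.subsingleton_iff.mpr rfl

lemma colength_eq_of_le {U V : Submodule R F} (h : U ≤ V) :
    colength U = Module.length R (LinearMap.ker (Submodule.factor h)) + colength V := by
  unfold colength
  exact Module.length_eq_add_of_exact (LinearMap.ker (Submodule.factor h)).subtype
    (Submodule.factor h) (Submodule.injective_subtype _) (Submodule.factor_surjective h)
    (by rw [LinearMap.exact_iff, Submodule.range_subtype])

lemma colength_anti {U V : Submodule R F} (h : U ≤ V) : colength V ≤ colength U := by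
  rw [colength_eq_of_le h]; exact le_add_self

lemma eq_of_colength_le {U V : Submodule R F} (h : U ≤ V) (hV : colength V ≠ ⊤)
    (hle : colength U ≤ colength V) : U = V := by
  rw [colength_eq_of_le h] at hle
  have h0 : Module.length R (LinearMap.ker (Submodule.factor h)) = 0 := by
    by_contra hne
    have h1 : 1 ≤ Module.length R (LinearMap.ker (Submodule.factor h)) :=
      Order.one_le_iff_pos.mpr (pos_iff_ne_zero.mpr hne)
    have h2 : 1 + colength V ≤ colength V := (add_le_add_left h1 _).trans hle
    have h3 : colength V + 1 ≤ colength V := by rwa [add_comm]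
    exact absurd ((ENat.add_one_le_iff hV).mp h3) (lt_irrefl _)
  rw [Module.length_eq_zero_iff] at h0
  refine le_antisymm h fun v hv => ?_
  have : (Submodule.Quotient.mk v : F ⧸ U) ∈ LinearMap.ker (Submodule.factor h) := by
    rw [LinearMap.mem_ker]
    exact (Submodule.Quotient.mk_eq_zero V).mpr hv
  have h2 := Subsingleton.elim (⟨_, this⟩ : LinearMap.ker (Submodule.factor h)) 0
  exact (Submodule.Quotient.mk_eq_zero U).mp (congrArg Subtype.val h2)

lemma colength_map_of_injective (φ : F →ₗ[R] F) (hφ : Function.Injective φ)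
    (U : Submodule R F) : colength (U.map φ) = colength U + colength (LinearMap.range φ) := by
  have hle : U.map φ ≤ LinearMap.range φ := LinearMap.map_le_range
  unfold colength
  refine Module.length_eq_add_of_exact (Submodule.mapQ U (U.map φ) φ (Submodule.le_comap_map φ U))
    (Submodule.factor hle) ?_ (Submodule.factor_surjective hle) ?_
  · rw [← LinearMap.ker_eq_bot, Submodule.ker_mapQ, Submodule.comap_map_eq_of_injective hφ,
      Submodule.mkQ_map_self]
  · rw [LinearMap.exact_iff, Submodule.range_mapQ]
    ext q
    obtain ⟨v, rfl⟩ := Submodule.mkQ_surjective _ q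
    rw [LinearMap.mem_ker]
    constructor
    · intro h
      exact Submodule.mem_map_of_mem ((Submodule.Quotient.mk_eq_zero _).mp h)
    · rintro ⟨w, hw, hwv⟩
      rw [← hwv]
      exact (Submodule.Quotient.mk_eq_zero _).mpr hw

lemma colength_pi {d : ℕ} (N : Ideal R) :
    colength (Submodule.pi Set.univ fun _ : Fin d => N) = d * colength N := by
  unfold colength
  classical
  rw [(Submodule.quotientPi fun _ : Fin d => N).length_eq, Module.length_pi_of_fintype]
  simp

end Colength

section MinimalGenerators

open IsLocalRing

variable {R : Type*} [CommRing R] [IsLocalRing R]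


def genMap {l : ℕ} (g : Fin l → R) (N : Ideal R) : (Fin l → R) →ₗ[R] (R ⧸ (maximalIdeal R * N)) :=
  (Submodule.mkQ (maximalIdeal R * N)).comp (Fintype.linearCombination R g)

lemma genMap_apply {l : ℕ} (g : Fin l → R) (N : Ideal R) (c : Fin l → R) :
    genMap g N c = Submodule.Quotient.mk (∑ i, c i * g i) := by
  simp [genMap, Fintype.linearCombination_apply]

lemma length_pi_quotient_maximalIdeal (l : ℕ) :
    Module.length R ((Fin l → R) ⧸ Submodule.pi Set.univ fun _ : Fin l => maximalIdeal R) = l := by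
  have h := colength_pi (d := l) (maximalIdeal R)
  unfold colength at h
  have : IsSimpleModule R (R ⧸ maximalIdeal R) :=
    (isSimpleModule_iff_isCoatom).mpr (Ideal.isMaximal_def.mp inferInstance)
  rw [h, Module.length_eq_one, mul_one]

lemma colength_mul_aux {l : ℕ} (g : Fin l → R) (N : Ideal R)
    (hg : Ideal.span (Set.range g) = N) :
    colength (maximalIdeal R * N : Ideal R) =
      Module.length R (LinearMap.range (genMap g N)) + colength N := by
  have hle : maximalIdeal R * N ≤ N := Ideal.mul_le_right
  unfold colength
  refine Module.length_eq_add_of_exact (LinearMap.range (genMap g N)).subtype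
    (Submodule.factor hle) (Submodule.injective_subtype _) (Submodule.factor_surjective hle) ?_
  rw [LinearMap.exact_iff, Submodule.range_subtype]
  ext q
  obtain ⟨v, rfl⟩ := Submodule.mkQ_surjective _ q
  rw [LinearMap.mem_ker]
  have hmem : v ∈ N ↔ ∃ c : Fin l → R, ∑ i, c i * g i = v := by
    rw [← hg]; exact Submodule.mem_span_range_iff_exists_fun R
  constructor
  · intro h
    obtain ⟨c, hc⟩ := hmem.mp ((Submodule.Quotient.mk_eq_zero _).mp h)
    exact ⟨c, by rw [genMap_apply, hc]; rfl⟩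
  · rintro ⟨c, hc⟩
    rw [genMap_apply] at hc
    rw [← hc]
    have h : ∑ i, c i * g i ∈ N :=
      Ideal.sum_mem _ fun i _ => Ideal.mul_mem_left _ _ (hg.le (Ideal.subset_span ⟨i, rfl⟩))
    exact (Submodule.Quotient.mk_eq_zero N).mpr h

lemma sum_mul_mem_maximalIdeal_mul {l : ℕ} (g : Fin l → R) (N : Ideal R)
    (hg : ∀ i, g i ∈ N) (c : Fin l → R) (hc : ∀ i, c i ∈ maximalIdeal R) :
    ∑ i, c i * g i ∈ maximalIdeal R * N :=
  Ideal.sum_mem _ fun i _ => Ideal.mul_mem_mul (hc i) (hg i)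

lemma pi_le_ker_genMap {l : ℕ} (g : Fin l → R) (N : Ideal R)
    (hg : Ideal.span (Set.range g) = N) :
    (Submodule.pi Set.univ fun _ : Fin l => maximalIdeal R) ≤ LinearMap.ker (genMap g N) := by
  intro c hc
  rw [LinearMap.mem_ker, genMap_apply]
  refine (Submodule.Quotient.mk_eq_zero _).mpr
    (sum_mul_mem_maximalIdeal_mul g N (fun i => ?_) c fun i => hc i trivial)
  rw [← hg]; exact Ideal.subset_span ⟨i, rfl⟩

lemma colength_maximalIdeal_mul_le {l : ℕ} (g : Fin l → R) (N : Ideal R)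
    (hg : Ideal.span (Set.range g) = N) : colength (maximalIdeal R * N : Ideal R) ≤ l + colength N := by
  rw [colength_mul_aux g N hg]
  gcongr
  rw [← length_pi_quotient_maximalIdeal (R := R) l,
    ← Submodule.range_liftQ _ _ (pi_le_ker_genMap g N hg)]
  exact Module.length_le_of_surjective _ (LinearMap.surjective_rangeRestrict _)

/-- A family of elements is a minimal system of generators of the ideal `N`. -/
structure IsMinGen {l : ℕ} (g : Fin l → R) (N : Ideal R) : Prop where
  span_eq : Ideal.span (Set.range g) = N
  coeff_mem : ∀ c : Fin l → R, ∑ i, c i * g i ∈ maximalIdeal R * N → ∀ i, c i ∈ maximalIdeal R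

lemma IsMinGen.mem {l : ℕ} {g : Fin l → R} {N : Ideal R} (h : IsMinGen g N) (i : Fin l) :
    g i ∈ N := by
  rw [← h.span_eq]; exact Ideal.subset_span ⟨i, rfl⟩

lemma IsMinGen.mem_iff {l : ℕ} {g : Fin l → R} {N : Ideal R} (h : IsMinGen g N) {v : R} :
    v ∈ N ↔ ∃ c : Fin l → R, ∑ i, c i * g i = v := by
  rw [← h.span_eq]; exact Submodule.mem_span_range_iff_exists_fun R

lemma IsMinGen.colength_mul {l : ℕ} {g : Fin l → R} {N : Ideal R} (h : IsMinGen g N) :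
    colength (maximalIdeal R * N : Ideal R) = l + colength N := by
  rw [colength_mul_aux g N h.span_eq, ← length_pi_quotient_maximalIdeal (R := R) l,
    ← Submodule.range_liftQ _ _ (pi_le_ker_genMap g N h.span_eq)]
  congr 1
  refine (LinearEquiv.ofInjective _ ?_).length_eq.symm
  rw [← LinearMap.ker_eq_bot, Submodule.ker_liftQ_eq_bot]
  intro c hc
  rw [LinearMap.mem_ker, genMap_apply] at hc
  exact fun i _ => h.coeff_mem c ((Submodule.Quotient.mk_eq_zero _).mp hc) i

/-- To check minimality of a generating system it suffices to look at honest relations. -/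
lemma IsMinGen.of_relations {l : ℕ} {g : Fin l → R} {N : Ideal R}
    (hg : Ideal.span (Set.range g) = N)
    (h : ∀ c : Fin l → R, ∑ i, c i * g i = 0 → ∀ i, c i ∈ maximalIdeal R) : IsMinGen g N := by
  refine ⟨hg, fun c hc i => ?_⟩
  have hc' : ∑ i, c i * g i ∈ maximalIdeal R • Submodule.span R (Set.range g) := by
    rw [← hg] at hc; exact hc
  obtain ⟨a, ha⟩ := (Submodule.mem_ideal_smul_span_iff_exists_sum (maximalIdeal R) g _).mp hc'
  obtain ⟨ha, hs⟩ := ha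
  have h1 := h (fun i => c i - a i) (by
    rw [Finsupp.sum_fintype _ _ (by simp)] at hs
    simp only [sub_mul, Finset.sum_sub_distrib, ← hs, smul_eq_mul, sub_self]) i
  have := Ideal.add_mem _ h1 (ha i)
  simpa using this

lemma exists_isMinGen [IsNoetherianRing R] (N : Ideal R) :
    ∃ (l : ℕ) (g : Fin l → R), IsMinGen g N := by
  classical
  have hex : ∃ l : ℕ, ∃ g : Fin l → R, Ideal.span (Set.range g) = N := by
    obtain ⟨n, s, hs⟩ := Submodule.fg_iff_exists_fin_generating_family.mp
      (IsNoetherian.noetherian N)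
    exact ⟨n, s, hs⟩
  obtain ⟨l, ⟨g, hg⟩, hlmin⟩ : ∃ l : ℕ, (∃ g : Fin l → R, Ideal.span (Set.range g) = N) ∧
      ∀ k < l, ¬ ∃ g : Fin k → R, Ideal.span (Set.range g) = N :=
    ⟨Nat.find hex, Nat.find_spec hex, fun k hk => Nat.find_min hex hk⟩
  refine ⟨l, g, hg, fun c hc i => ?_⟩
  by_contra hi
  have hu : IsUnit (c i) := by simpa using hi
  obtain ⟨l', rfl⟩ : ∃ l', l = l' + 1 := ⟨l - 1, by have := i.pos; omega⟩
  have hmin := hlmin l' (Nat.lt_succ_self l')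
  refine hmin ⟨fun j => g (i.succAbove j), ?_⟩
  have hgN : ∀ j, g j ∈ N := fun j => by rw [← hg]; exact Ideal.subset_span ⟨j, rfl⟩
  apply le_antisymm
  · rw [Ideal.span_le]; rintro _ ⟨j, rfl⟩; exact hgN _
  · refine Submodule.le_of_le_smul_of_le_jacobson_bot (I := maximalIdeal R) (IsNoetherian.noetherian N)
      (maximalIdeal_le_jacobson _) ?_
    conv_lhs => rw [← hg]
    rw [Ideal.span_le]
    rintro _ ⟨j, rfl⟩
    rcases eq_or_ne j i with rfl | hj
    · rw [Fin.sum_univ_succAbove _ j] at hc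
      have h1 : ∑ x, c (j.succAbove x) * g (j.succAbove x) ∈
          Ideal.span (Set.range fun x => g (j.succAbove x)) :=
        Ideal.sum_mem _ fun x _ => Ideal.mul_mem_left _ _ (Ideal.subset_span ⟨x, rfl⟩)
      have h2 : c j * g j ∈ Ideal.span (Set.range fun x => g (j.succAbove x)) ⊔ maximalIdeal R * N := by
        have h3 := Submodule.sub_mem (Ideal.span (Set.range fun x => g (j.succAbove x)) ⊔
          maximalIdeal R * N) (Submodule.mem_sup_right hc) (Submodule.mem_sup_left h1)
        simpa using h3
      have := Ideal.mul_mem_left _ (↑hu.unit⁻¹ : R) h2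
      rw [← mul_assoc, IsUnit.val_inv_mul, one_mul] at this
      exact this
    · obtain ⟨x, rfl⟩ := Fin.exists_succAbove_eq hj
      exact Submodule.mem_sup_left (Ideal.subset_span ⟨x, rfl⟩)

lemma colength_maximalIdeal_pow_ne_top [IsNoetherianRing R] (n : ℕ) :
    colength (maximalIdeal R ^ n : Ideal R) ≠ ⊤ := by
  induction n with
  | zero => rw [pow_zero, Ideal.one_eq_top, colength_top]; exact ENat.zero_ne_top
  | succ n ih =>
    obtain ⟨l, g, hg⟩ := exists_isMinGen (maximalIdeal R ^ n : Ideal R)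
    rw [pow_succ', hg.colength_mul]
    exact WithTop.add_ne_top.mpr ⟨ENat.natCast_ne_top l, ih⟩

end MinimalGenerators

section MatrixReduction

open IsLocalRing Polynomial

variable {R : Type*} [CommRing R] [IsLocalRing R] [IsNoetherianRing R]

/-- The filtration of `R` by the ideals `(I ^ (n + 1) : I)`. -/
def colonFiltration {R : Type*} [CommRing R] (I : Ideal R) : I.Filtration R where
  N n :=
    { carrier := {v | ∀ x ∈ I, x * v ∈ I ^ (n + 1)}
      add_mem' := fun {a b} ha hb x hx => by
        rw [mul_add]; exact Ideal.add_mem _ (ha x hx) (hb x hx)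
      zero_mem' := fun x _ => by rw [mul_zero]; exact Ideal.zero_mem _
      smul_mem' := fun c v hv x hx => by
        rw [smul_eq_mul, mul_left_comm]; exact Ideal.mul_mem_left _ _ (hv x hx) }
  mono n v hv x hx := Ideal.pow_le_pow_right (Nat.le_succ _) (hv x hx)
  smul_le n := by
    rw [Submodule.smul_le]
    intro y hy v hv x hx
    rw [smul_eq_mul, pow_succ']
    exact Ideal.mul_mem_mul hx (hv y hy)

/-- The shifted adic filtration. -/
def shiftedFiltration {R : Type*} [CommRing R] (I : Ideal R) (k : ℕ) : I.Filtration R where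
  N n := I ^ (n + 1 - k)
  mono n := Ideal.pow_le_pow_right (by omega)
  smul_le n := by
    rw [smul_eq_mul, ← pow_succ']
    exact Ideal.pow_le_pow_right (by omega)

lemma shiftedFiltration_stable {R : Type*} [CommRing R] (I : Ideal R) (k : ℕ) :
    (shiftedFiltration I k).Stable := by
  refine ⟨k, fun n hn => ?_⟩
  change I * I ^ (n + 1 - k) = I ^ (n + 1 + 1 - k)
  rw [← pow_succ']
  congr 1
  omega

/-- If `I` contains a nonzerodivisor, then `(I ^ (n + 2) : I) = I ^ (n + 1)` for large `n`. -/
lemma exists_colon_pow_le {R : Type*} [CommRing R] [IsNoetherianRing R] (I : Ideal R) {z : R}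
    (hzm : z ∈ I) (hz : z ∈ nonZeroDivisors R) :
    ∃ n₁ : ℕ, ∀ n ≥ n₁, ∀ v : R, (∀ x ∈ I, x * v ∈ I ^ (n + 2)) → v ∈ I ^ (n + 1) := by
  obtain ⟨k, hk⟩ := I.exists_pow_inf_eq_pow_smul (M := R) (Ideal.span {z})
  have hle : colonFiltration I ≤ shiftedFiltration I k := by
    intro n v hv
    change v ∈ I ^ (n + 1 - k)
    rcases le_or_gt k (n + 1) with hkn | hkn
    · have h1 : z * v ∈ I ^ (n + 1) • (⊤ : Ideal R) ⊓ Ideal.span {z} :=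
        ⟨by rw [smul_eq_mul, Ideal.mul_top]; exact hv z hzm,
          Ideal.mul_mem_right _ _ (Ideal.mem_span_singleton_self z)⟩
      rw [hk _ hkn] at h1
      have h2 : z * v ∈ I ^ (n + 1 - k) * Ideal.span {z} :=
        Ideal.mul_mono le_rfl inf_le_right h1
      obtain ⟨w, hw, hwz⟩ := Ideal.mem_mul_span_singleton.mp h2
      rw [mul_comm w z] at hwz
      rwa [← (mul_cancel_left_mem_nonZeroDivisors hz).mp hwz]
    · rw [Nat.sub_eq_zero_of_le hkn.le, pow_zero, Ideal.one_eq_top]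
      trivial
  obtain ⟨n₁, h⟩ := (shiftedFiltration_stable I k).of_le hle
  refine ⟨n₁, fun n hn v hv => ?_⟩
  have h1 : v ∈ (colonFiltration I).N (n + 1) := hv
  rw [← h n hn] at h1
  refine (Submodule.smul_le.mpr ?_ : _ ≤ (I ^ (n + 1) : Ideal R)) h1
  intro x hx w hw
  exact hw x hx

/-- The polynomial `∑ xᵢ Xⁱ`. -/
def genericElement {R : Type*} [CommRing R] {r : ℕ} (x : Fin r → R) : R[X] :=
  ∑ i : Fin r, C (x i) * X ^ (i : ℕ)

lemma coeff_genericElement_mul {R : Type*} [CommRing R] {r : ℕ} (x : Fin r → R) (v : R[X])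
    (k : ℕ) : (genericElement x * v).coeff k =
      ∑ j : Fin r, x j * if (j : ℕ) ≤ k then v.coeff (k - j) else 0 := by
  simp only [genericElement, Finset.sum_mul, finsetSum_coeff, mul_assoc, coeff_C_mul,
    coeff_X_pow_mul']

lemma coeff_mem_of_genericElement_mul {R : Type*} [CommRing R] (I : Ideal R) {r : ℕ}
    (x : Fin r → R) (hx : Ideal.span (Set.range x) = I) (n₁ : ℕ)
    (h₁ : ∀ n ≥ n₁, ∀ v : R, (∀ x ∈ I, x * v ∈ I ^ (n + 2)) → v ∈ I ^ (n + 1)) (D : ℕ) :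
    ∀ n ≥ n₁, ∀ v : R[X], (∀ k, v.coeff k ∈ I ^ n) → (∀ k ≥ D, v.coeff k ∈ I ^ (n + 1)) →
      (∀ k, (genericElement x * v).coeff k ∈ I ^ (n + 2)) → ∀ k, v.coeff k ∈ I ^ (n + 1) := by
  have hxI : ∀ i, x i ∈ I := fun i => hx ▸ Ideal.subset_span ⟨i, rfl⟩
  induction D with
  | zero => intro n _ v _ h _ k; exact h k (Nat.zero_le _)
  | succ D ih =>
    intro n hn v hv hD hξ
    have key : ∀ t : ℕ, ∀ i : Fin r, r - (i : ℕ) ≤ t → ∀ k, x i * v.coeff k ∈ I ^ (n + 2) := by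
      intro t
      induction t with
      | zero => intro i hi; exact absurd i.2 (by omega)
      | succ t iht =>
        intro i hi
        have hDk : x i * v.coeff D ∈ I ^ (n + 2) := by
          have h := hξ (D + i)
          rw [coeff_genericElement_mul, ← Finset.add_sum_erase _ _ (Finset.mem_univ i),
            if_pos (Nat.le_add_left _ _), Nat.add_sub_cancel] at h
          refine (Ideal.add_mem_iff_left _ (Ideal.sum_mem _ fun j hj => ?_)).mp h
          have hji : (j : ℕ) ≠ i := fun h => (Finset.ne_of_mem_erase hj) (Fin.ext h)
          split_ifs with hjk
          · rcases lt_or_gt_of_ne hji with hlt | hgt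
            · rw [show n + 2 = (n + 1) + 1 from rfl, pow_succ']
              exact Ideal.mul_mem_mul (hxI j) (hD _ (by omega))
            · exact iht j (by omega) _
          · rw [mul_zero]; exact Ideal.zero_mem _
        have := ih (n + 1) (by omega) (C (x i) * v)
          (fun k => by
            rw [coeff_C_mul, pow_succ']; exact Ideal.mul_mem_mul (hxI i) (hv k))
          (fun k hk => by
            rw [coeff_C_mul]
            rcases hk.eq_or_lt with rfl | hlt
            · exact hDk
            · rw [pow_succ']; exact Ideal.mul_mem_mul (hxI i) (hD k hlt))
          (fun k => by
            rw [mul_left_comm, coeff_C_mul, show n + 1 + 2 = (n + 2) + 1 from rfl, pow_succ']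
            exact Ideal.mul_mem_mul (hxI i) (hξ k))
        intro k
        have hk := this k
        rwa [coeff_C_mul] at hk
    intro k
    refine h₁ n hn _ fun y hy => ?_
    rw [← hx] at hy
    induction hy using Submodule.span_induction with
    | mem y hy => obtain ⟨i, rfl⟩ := hy; exact key r i (Nat.sub_le _ _) k
    | zero => rw [zero_mul]; exact Ideal.zero_mem _
    | add a b _ _ ha hb => rw [add_mul]; exact Ideal.add_mem _ ha hb
    | smul a y _ hy => rw [smul_eq_mul, mul_assoc]; exact Ideal.mul_mem_left _ _ hy

/-- The coefficient matrix of multiplication by the generic element. -/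
lemma exists_adjugate_data {z : R} (hzm : z ∈ maximalIdeal R) (hz : z ∈ nonZeroDivisors R)
    (e N₀ : ℕ) (he : ∀ n ≥ N₀,
      colength (maximalIdeal R ^ (n + 1)) = colength (maximalIdeal R ^ n) + e) :
    ∃ (n r : ℕ) (x : Fin r → R) (w : Fin e → R) (D : R[X]) (f : Fin e → R[X]),
      (∀ i, x i ∈ maximalIdeal R) ∧ Ideal.span (Set.range w) = maximalIdeal R ^ (n + 1) ∧
      (∃ k, D.coeff k ∉ maximalIdeal R) ∧ (∀ h k, (f h).coeff k ∈ maximalIdeal R ^ n) ∧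
      N₀ ≤ n ∧ ∀ h, genericElement x * f h = D * C (w h) := by
  obtain ⟨n₁, h₁⟩ := exists_colon_pow_le (maximalIdeal R) hzm hz
  obtain ⟨r, x, hx⟩ := Submodule.fg_iff_exists_fin_generating_family.mp
    (IsNoetherian.noetherian (maximalIdeal R))
  change Ideal.span (Set.range x) = maximalIdeal R at hx
  have hxm : ∀ i, x i ∈ maximalIdeal R := fun i => hx ▸ Ideal.subset_span ⟨i, rfl⟩
  have hcard : ∀ n ≥ N₀, ∃ g : Fin e → R, IsMinGen g (maximalIdeal R ^ n) := by
    intro n hn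
    obtain ⟨l, g, hg⟩ := exists_isMinGen (maximalIdeal R ^ n)
    have h := hg.colength_mul
    rw [← pow_succ', he n hn, add_comm] at h
    have hl : (e : ℕ∞) = l :=
      WithTop.add_right_cancel (colength_maximalIdeal_pow_ne_top n) h
    obtain rfl : e = l := by exact_mod_cast hl
    exact ⟨g, hg⟩
  set n := max N₀ n₁ with hn
  have hnN : N₀ ≤ n := le_max_left _ _
  have hn1 : n₁ ≤ n := le_max_right _ _
  obtain ⟨v, hv⟩ := hcard n hnN
  obtain ⟨w, hw⟩ := hcard (n + 1) (by omega)
  have hc : ∀ i j, ∃ c : Fin e → R, ∑ h, c h * w h = x i * v j := fun i j =>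
    hw.mem_iff.mp (by rw [pow_succ']; exact Ideal.mul_mem_mul (hxm i) (hv.mem j))
  choose c hc using hc
  let M : Matrix (Fin e) (Fin e) R[X] := fun h j => ∑ i : Fin r, C (c i j h) * X ^ (i : ℕ)
  have hM : ∀ j, genericElement x * C (v j) = ∑ h, M h j * C (w h) := by
    intro j
    simp only [genericElement, M, Finset.sum_mul]
    rw [Finset.sum_comm]
    refine Finset.sum_congr rfl fun i _ => ?_
    rw [mul_right_comm, ← C_mul, ← hc, map_sum, Finset.sum_mul]
    refine Finset.sum_congr rfl fun h _ => ?_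
    rw [C_mul]; ring
  refine ⟨n, r, x, w, M.det, fun h => ∑ j, M.adjugate j h * C (v j), hxm, hw.span_eq, ?_, ?_,
    hnN, ?_⟩
  · by_contra! hcon
    let π := mapRingHom (residue R)
    have hdet : (π.mapMatrix M).det = 0 := by
      rw [← RingHom.map_det]
      ext k
      simpa [π, coeff_map, residue_eq_zero_iff] using hcon k
    obtain ⟨ub, hub0, hub⟩ := Matrix.exists_mulVec_eq_zero_iff.mpr hdet
    have hsurj : Function.Surjective π := map_surjective _ residue_surjective
    choose u hu using fun j => hsurj (ub j)
    have hMu : ∀ h k, (∑ j, M h j * u j).coeff k ∈ maximalIdeal R := by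
      intro h k
      rw [← residue_eq_zero_iff, ← coeff_map]
      change (π (∑ j, M h j * u j)).coeff k = 0
      have := congrFun hub h
      simp only [Matrix.mulVec, dotProduct, RingHom.mapMatrix_apply, Matrix.map_apply,
        Pi.zero_apply, ← hu, ← map_mul, ← map_sum] at this
      rw [this, coeff_zero]
    have hV : ∀ k, (∑ j, u j * C (v j)).coeff k ∈ maximalIdeal R ^ (n + 1) := by
      have hVn : ∀ k, (∑ j, u j * C (v j)).coeff k ∈ maximalIdeal R ^ n := by
        intro k
        rw [finsetSum_coeff]
        refine Ideal.sum_mem _ fun j _ => ?_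
        rw [coeff_mul_C]
        exact Ideal.mul_mem_left _ _ (hv.mem j)
      refine coeff_mem_of_genericElement_mul (maximalIdeal R) x hx n₁ h₁
        ((∑ j, u j * C (v j)).natDegree + 1) n hn1 _ hVn (fun k hk => ?_) (fun k => ?_)
      · rw [coeff_eq_zero_of_natDegree_lt (by omega)]
        exact Ideal.zero_mem _
      · have : genericElement x * ∑ j, u j * C (v j) =
            ∑ h, (∑ j, M h j * u j) * C (w h) := by
          simp only [Finset.mul_sum, mul_left_comm _ (u _), hM, Finset.sum_mul]
          rw [Finset.sum_comm]
          refine Finset.sum_congr rfl fun h _ => Finset.sum_congr rfl fun j _ => ?_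
          ring
        rw [this, finsetSum_coeff, show n + 2 = (n + 1) + 1 from rfl, pow_succ']
        refine Ideal.sum_mem _ fun h _ => ?_
        rw [coeff_mul_C]
        exact Ideal.mul_mem_mul (hMu h k) (hw.mem h)
    apply hub0
    funext j
    rw [← hu j, Pi.zero_apply]
    ext k
    have h := hV k
    simp only [finsetSum_coeff, coeff_mul_C] at h
    rw [pow_succ'] at h
    simpa [π, coeff_map, residue_eq_zero_iff] using
      hv.coeff_mem (fun j => (u j).coeff k) h j
  · intro h k
    rw [finsetSum_coeff]
    refine Ideal.sum_mem _ fun j _ => ?_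
    rw [coeff_mul_C]
    exact Ideal.mul_mem_left _ _ (hv.mem j)
  · intro h
    have hadj : ∀ h', ∑ j, M h' j * M.adjugate j h = if h' = h then M.det else 0 := by
      intro h'
      have := congrFun (congrFun M.mul_adjugate h') h
      rw [Matrix.mul_apply] at this
      rw [this, Matrix.smul_apply, Matrix.one_apply]
      simp
    calc genericElement x * ∑ j, M.adjugate j h * C (v j)
        = ∑ j, ∑ h', (M h' j * M.adjugate j h) * C (w h') := by
          simp only [Finset.mul_sum, mul_left_comm _ (M.adjugate _ _), hM]
          refine Finset.sum_congr rfl fun j _ => Finset.sum_congr rfl fun h' _ => ?_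
          ring
      _ = ∑ h', (if h' = h then M.det else 0) * C (w h') := by
          rw [Finset.sum_comm]
          simp only [← hadj, Finset.sum_mul]
      _ = M.det * C (w h) := by simp

lemma mem_smul_top_iff_repr {R E ι : Type*} [CommRing R] [AddCommGroup E] [Module R E]
    [Fintype ι] (b : Module.Basis ι R E) (N : Ideal R) (y : E) :
    y ∈ N • (⊤ : Submodule R E) ↔ ∀ i, b.equivFun y i ∈ N := by
  constructor
  · intro hy
    induction hy using Submodule.smul_induction_on' with
    | smul r hr n _ => intro i; simpa using Ideal.mul_mem_right _ _ hr
    | add x _ y _ hx hy => intro i; simpa using Ideal.add_mem _ (hx i) (hy i)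
  · intro h
    rw [← b.sum_equivFun y]
    exact Submodule.sum_mem _ fun i _ => Submodule.smul_mem_smul (h i) trivial

lemma aeval_mem_smul_top {R E : Type*} [CommRing R] [CommRing E] [Algebra R E] (N : Ideal R)
    (f : R[X]) (hf : ∀ k, f.coeff k ∈ N) (θ y : E) :
    aeval θ f * y ∈ N • (⊤ : Submodule R E) := by
  rw [aeval_eq_sum_range, Finset.sum_mul]
  refine Submodule.sum_mem _ fun i _ => ?_
  rw [smul_mul_assoc]
  exact Submodule.smul_mem_smul (hf i) trivial


lemma exists_monic_approx {R : Type*} [CommRing R] [IsLocalRing R] (D : R[X]) (hD : ∃ k, D.coeff k ∉ maximalIdeal R) :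
    ∃ (p : R[X]) (c : R), p.Monic ∧ ∀ k, (C c * D - p).coeff k ∈ maximalIdeal R := by
  set Db := D.map (residue R) with hDb
  have hne : Db ≠ 0 := by
    obtain ⟨k, hk⟩ := hD
    intro h0
    apply hk
    rw [← residue_eq_zero_iff, ← coeff_map, ← hDb, h0, coeff_zero]
  have hmon : (C Db.leadingCoeff⁻¹ * Db).Monic := by
    rw [mul_comm]; exact monic_mul_leadingCoeff_inv hne
  obtain ⟨c, hc⟩ := residue_surjective (R := R) Db.leadingCoeff⁻¹
  have hl : C Db.leadingCoeff⁻¹ * Db ∈ lifts (residue R) :=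
    (mem_lifts _).mpr ⟨C c * D, by rw [Polynomial.map_mul, map_C, hc]⟩
  obtain ⟨p, hp, -, hpm⟩ := lifts_and_natDegree_eq_and_monic hl hmon
  refine ⟨p, c, hpm, fun k => ?_⟩
  rw [← residue_eq_zero_iff, ← coeff_map, Polynomial.map_sub, hp, Polynomial.map_mul, map_C, hc,
    ← hDb, sub_self, coeff_zero]

/-- There is a power `Rᵈ` with an injective endomorphism which sends `Nᵈ` into `(𝔪N)ᵈ` for every
ideal `N` and whose cokernel has length `d * e`. -/
theorem exists_matrix_reduction {z : R} (hzm : z ∈ maximalIdeal R) (hz : z ∈ nonZeroDivisors R)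
    (e N₀ : ℕ) (he : ∀ n ≥ N₀,
      colength (maximalIdeal R ^ (n + 1)) = colength (maximalIdeal R ^ n) + e) :
    ∃ (d : ℕ) (φ : (Fin d → R) →ₗ[R] (Fin d → R)), 0 < d ∧ Function.Injective φ ∧
      (∀ N : Ideal R, ∀ c, (∀ i, c i ∈ N) → ∀ i, φ c i ∈ maximalIdeal R * N) ∧
      colength (LinearMap.range φ) = d * e := by
  obtain ⟨n, r, x, w, D, f, hxm, hw, hD, hf, hn, hfD⟩ := exists_adjugate_data hzm hz e N₀ he
  obtain ⟨p, c₁, hp, hpD⟩ := exists_monic_approx D hD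
  have hXp : (X * p).Monic := monic_X.mul hp
  have hdeg : (X * p : R[X]).natDegree = p.natDegree + 1 := by
    rw [monic_X.natDegree_mul hp, natDegree_X, add_comm]
  have hlt : (1 : R[X]).degree < (X * p : R[X]).degree := by
    rw [degree_one, degree_eq_natDegree hXp.ne_zero, hdeg]
    exact_mod_cast Nat.succ_pos _
  set q : R[X] := X * p + 1 with hqdef
  have hq : q.Monic := hXp.add_of_left hlt
  let θ : AdjoinRoot q := AdjoinRoot.root q
  have hθ : θ * aeval θ p = -1 := by
    have h0 : aeval θ q = 0 := by
      rw [AdjoinRoot.aeval_eq, AdjoinRoot.mk_self]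
    have h : aeval θ (X * p + 1) = 0 := h0
    rw [map_add, map_mul, aeval_X, map_one] at h
    exact eq_neg_of_add_eq_zero_left h
  let b := (AdjoinRoot.powerBasis' hq).basis
  set d := (AdjoinRoot.powerBasis' hq).dim with hd
  have hdpos : 0 < d := by
    rw [hd, AdjoinRoot.powerBasis'_dim, hqdef, natDegree_add_eq_left_of_degree_lt hlt, hdeg]
    exact Nat.succ_pos _
  let a : AdjoinRoot q := aeval θ (genericElement x)
  have haN : ∀ N : Ideal R, ∀ y ∈ N • (⊤ : Submodule R (AdjoinRoot q)),
      a * y ∈ (maximalIdeal R * N) • (⊤ : Submodule R (AdjoinRoot q)) := by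
    intro N y hy
    rw [← smul_eq_mul, Submodule.smul_assoc]
    induction hy using Submodule.smul_induction_on' with
    | smul s hs y _ =>
      have h : a * y ∈ maximalIdeal R • (⊤ : Submodule R (AdjoinRoot q)) := by
        refine aeval_mem_smul_top _ _ (fun k => ?_) θ y
        have := coeff_genericElement_mul x 1 k
        rw [mul_one] at this
        rw [this]
        exact Ideal.sum_mem _ fun j _ => Ideal.mul_mem_right _ _ (hxm j)
      rw [mul_smul_comm, ← Submodule.smul_assoc, smul_eq_mul, mul_comm, ← smul_eq_mul,
        Submodule.smul_assoc]
      exact Submodule.smul_mem_smul hs h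
    | add y _ y' _ h h' => rw [mul_add]; exact Submodule.add_mem _ h h'
  let μ : AdjoinRoot q →ₗ[R] AdjoinRoot q := LinearMap.mulLeft R a
  have hfin : (maximalIdeal R ^ (n + 1) • (⊤ : Submodule R (AdjoinRoot q))).FG := by
    have := hq.finite_adjoinRoot
    exact IsNoetherian.noetherian _
  have hV : maximalIdeal R ^ (n + 1) • (⊤ : Submodule R (AdjoinRoot q)) ≤
      (maximalIdeal R ^ n • (⊤ : Submodule R (AdjoinRoot q))).map μ := by
    refine Submodule.le_of_le_smul_of_le_jacobson_bot (I := maximalIdeal R) hfin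
      (maximalIdeal_le_jacobson _) ?_
    have hgen : ∀ h y, w h • y ∈ (maximalIdeal R ^ n • (⊤ : Submodule R (AdjoinRoot q))).map μ ⊔
        maximalIdeal R • maximalIdeal R ^ (n + 1) • (⊤ : Submodule R (AdjoinRoot q)) := by
      intro h y
      have h1 : a * aeval θ (f h) = aeval θ D * algebraMap R _ (w h) := by
        rw [← map_mul, hfD, map_mul, aeval_C]
      have h2 : w h • y = μ (aeval θ (f h) * (-(θ * algebraMap R _ c₁ * y))) +
          (w h) • (aeval θ (C c₁ * D - p) * (θ * y)) := by
        simp only [μ, LinearMap.mulLeft_apply, map_sub, map_mul, aeval_C, Algebra.smul_def]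
        linear_combination (θ * algebraMap R _ c₁ * y) * h1 +
          (algebraMap R _ (w h) * y) * hθ
      rw [h2]
      refine Submodule.add_mem_sup (Submodule.mem_map_of_mem (aeval_mem_smul_top _ _ (hf h) _ _)) ?_
      rw [← Submodule.smul_assoc, smul_eq_mul, mul_comm, ← smul_eq_mul, Submodule.smul_assoc]
      refine Submodule.smul_mem_smul ?_ (aeval_mem_smul_top _ _ hpD _ _)
      rw [← hw]; exact Ideal.subset_span ⟨h, rfl⟩
    rw [Submodule.smul_le]
    intro s hs y _
    rw [← hw] at hs
    induction hs using Submodule.span_induction with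
    | mem s hs => obtain ⟨h, rfl⟩ := hs; exact hgen h y
    | zero => rw [zero_smul]; exact Submodule.zero_mem _
    | add s t _ _ hs ht => rw [add_smul]; exact Submodule.add_mem _ hs ht
    | smul t s _ hs => rw [smul_assoc]; exact Submodule.smul_mem _ _ hs
  have hμinj : Function.Injective μ := by
    rw [injective_iff_map_eq_zero]
    intro y hy
    have h1 : z ^ (n + 1) • (1 : AdjoinRoot q) ∈
        maximalIdeal R ^ (n + 1) • (⊤ : Submodule R (AdjoinRoot q)) :=
      Submodule.smul_mem_smul (Ideal.pow_mem_pow hzm _) trivial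
    obtain ⟨t, -, ht⟩ := hV h1
    have h2 : z ^ (n + 1) • y = 0 := by
      have h3 : z ^ (n + 1) • y = t * (a * y) := by
        rw [← one_mul y, ← smul_mul_assoc, ← ht]
        simp only [μ, LinearMap.mulLeft_apply, one_mul]
        ring
      rw [h3]
      have h4 : a * y = 0 := hy
      rw [h4, mul_zero]
    apply b.equivFun.injective
    rw [map_zero]
    funext i
    have h5 := congrFun (congrArg b.equivFun h2) i
    rw [map_smul, map_zero, Pi.smul_apply, Pi.zero_apply, smul_eq_mul] at h5
    exact (mul_left_mem_nonZeroDivisors_eq_zero_iff (pow_mem hz (n + 1))).mp h5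
  let φ : (Fin d → R) →ₗ[R] (Fin d → R) :=
    b.equivFun.toLinearMap ∘ₗ μ ∘ₗ b.equivFun.symm.toLinearMap
  have hφinj : Function.Injective φ :=
    b.equivFun.injective.comp (hμinj.comp b.equivFun.symm.injective)
  have hφN : ∀ N : Ideal R, ∀ c, (∀ i, c i ∈ N) → ∀ i, φ c i ∈ maximalIdeal R * N := by
    intro N c hc
    refine (mem_smul_top_iff_repr b _ _).mp (haN N _ ((mem_smul_top_iff_repr b _ _).mpr ?_))
    intro i
    have : b.equivFun (b.equivFun.symm c) i ∈ N := by
      rw [LinearEquiv.apply_symm_apply]; exact hc i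
    exact this
  refine ⟨d, φ, hdpos, hφinj, hφN, ?_⟩
  have hmap : (Submodule.pi Set.univ fun _ : Fin d => maximalIdeal R ^ n).map φ =
      Submodule.pi Set.univ fun _ : Fin d => maximalIdeal R ^ (n + 1) := by
    apply le_antisymm
    · rintro _ ⟨c, hc, rfl⟩ i _
      rw [pow_succ']
      exact hφN _ c (fun i => hc i trivial) i
    · intro c hc
      have h1 : b.equivFun.symm c ∈ maximalIdeal R ^ (n + 1) • (⊤ : Submodule R (AdjoinRoot q)) := by
        rw [mem_smul_top_iff_repr b]
        intro i
        rw [LinearEquiv.apply_symm_apply]; exact hc i trivial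
      obtain ⟨y, hy, hyc⟩ := hV h1
      refine ⟨b.equivFun y, fun i _ => (mem_smul_top_iff_repr b _ _).mp hy i, ?_⟩
      simp only [φ, LinearMap.comp_apply, LinearEquiv.coe_coe, LinearEquiv.symm_apply_apply]
      rw [hyc, LinearEquiv.apply_symm_apply]
  have h := colength_map_of_injective φ hφinj
    (Submodule.pi Set.univ fun _ : Fin d => maximalIdeal R ^ n)
  rw [hmap, colength_pi, colength_pi, he n hn, mul_add] at h
  refine (WithTop.add_left_cancel ?_ h).symm
  exact WithTop.mul_ne_top (ENat.natCast_ne_top d) (colength_maximalIdeal_pow_ne_top n)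

end MatrixReduction

section Syzygies

variable {R : Type*} [CommRing R]

/-- Every relation `∑ aᵢ gᵢ = 0` with `gᵢ ∈ J` is a consequence of the syzygies of the `aᵢ`. -/
def SyzCond {r : ℕ} (a : Fin r → R) (J : Ideal R) : Prop :=
  ∀ g : Fin r → R, (∀ i, g i ∈ J) → ∑ i, a i * g i = 0 →
    ∃ (k : ℕ) (p : Fin r → Fin k → R) (h : Fin k → R), (∀ κ, h κ ∈ J) ∧
      (∀ i, g i = ∑ κ, p i κ * h κ) ∧ ∀ κ, ∑ i, p i κ * a i = 0

lemma span_range_subtype_eq_top {r : ℕ} {a : Fin r → R} {I : Ideal R}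
    (ha : Ideal.span (Set.range a) = I) (hI : ∀ i, a i ∈ I) :
    Submodule.span R (Set.range fun i => (⟨a i, hI i⟩ : I)) = ⊤ := by
  rw [eq_top_iff]
  rintro ⟨x, hx⟩ -
  obtain ⟨c, hc⟩ := (Submodule.mem_span_range_iff_exists_fun R).mp
    (show x ∈ Ideal.span (Set.range a) from ha.symm ▸ hx)
  refine (Submodule.mem_span_range_iff_exists_fun R).mpr ⟨c, Subtype.ext ?_⟩
  simpa using hc

lemma syzCond_of_injective {r : ℕ} {a : Fin r → R} {I J : Ideal R}
    (hinj : Function.Injective (Submodule.mulMap I J)) (ha : Ideal.span (Set.range a) = I) :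
    SyzCond a J := by
  have haI : ∀ i, a i ∈ I := fun i => ha ▸ Ideal.subset_span ⟨i, rfl⟩
  intro g hg h0
  have h1 : ∑ i, (⟨a i, haI i⟩ : I) ⊗ₜ[R] (⟨g i, hg i⟩ : J) = 0 := by
    apply hinj
    rw [map_sum, map_zero]
    simpa only [Submodule.mulMap_tmul] using h0
  obtain ⟨k, p, h, hp, hh⟩ := TensorProduct.vanishesTrivially_of_sum_tmul_eq_zero R
    (span_range_subtype_eq_top ha haI) h1
  refine ⟨k, p, fun κ => h κ, fun κ => (h κ).2, fun i => ?_, fun κ => ?_⟩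
  · simpa using congrArg Subtype.val (hp i)
  · simpa using congrArg Subtype.val (hh κ)

lemma injective_of_syzCond {r : ℕ} {a : Fin r → R} {I J : Ideal R}
    (ha : Ideal.span (Set.range a) = I) (h : SyzCond a J) :
    Function.Injective (Submodule.mulMap I J) := by
  have haI : ∀ i, a i ∈ I := fun i => ha ▸ Ideal.subset_span ⟨i, rfl⟩
  have hrep : ∀ t : I ⊗[R] J, ∃ g : Fin r → J, t = ∑ i, (⟨a i, haI i⟩ : I) ⊗ₜ[R] g i := by
    intro t
    induction t using TensorProduct.induction_on with
    | zero => exact ⟨0, by simp⟩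
    | tmul x y =>
      obtain ⟨c, hc⟩ := (Submodule.mem_span_range_iff_exists_fun R).mp
        (show x ∈ Submodule.span R (Set.range fun i => (⟨a i, haI i⟩ : I)) by
          rw [span_range_subtype_eq_top ha haI]; trivial)
      refine ⟨fun i => c i • y, ?_⟩
      rw [← hc, TensorProduct.sum_tmul]
      simp only [TensorProduct.smul_tmul]
    | add t t' ht ht' =>
      obtain ⟨g, rfl⟩ := ht
      obtain ⟨g', rfl⟩ := ht'
      exact ⟨g + g', by simp only [Pi.add_apply, TensorProduct.tmul_add, Finset.sum_add_distrib]⟩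
  rw [injective_iff_map_eq_zero]
  intro t ht
  obtain ⟨g, rfl⟩ := hrep t
  rw [map_sum] at ht
  obtain ⟨k, p, q, hq, hpq, hp⟩ := h (fun i => g i) (fun i => (g i).2)
    (by simpa only [Submodule.mulMap_tmul] using ht)
  refine TensorProduct.sum_tmul_eq_zero_of_vanishesTrivially R
    ⟨k, p, fun κ => ⟨q κ, hq κ⟩, fun i => Subtype.ext ?_, fun κ => Subtype.ext ?_⟩
  · simpa using hpq i
  · simpa using hp κ

lemma injective_mulMap_comm {I J : Ideal R} (h : Function.Injective (Submodule.mulMap I J)) :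
    Function.Injective (Submodule.mulMap J I) := by
  rw [Submodule.mulMap_comm]
  exact h.comp (TensorProduct.comm R J I).injective

lemma span_range_mul {ι κ : Type*} (g : ι → R) (h : κ → R) :
    Ideal.span (Set.range fun p : ι × κ => g p.1 * h p.2) =
      Ideal.span (Set.range g) * Ideal.span (Set.range h) := by
  rw [Ideal.span_mul_span']
  congr 1
  ext x
  simp [Set.mem_mul]

lemma span_range_pair_sq (a : Fin 2 → R) :
    Ideal.span (Set.range ![a 0 * a 0, a 0 * a 1, a 1 * a 1]) =
      Ideal.span (Set.range a) * Ideal.span (Set.range a) := by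
  rw [← span_range_mul]
  apply le_antisymm
  · rw [Ideal.span_le]
    rintro _ ⟨i, rfl⟩
    fin_cases i
    · exact Ideal.subset_span ⟨(0, 0), rfl⟩
    · exact Ideal.subset_span ⟨(0, 1), rfl⟩
    · exact Ideal.subset_span ⟨(1, 1), rfl⟩
  · rw [Ideal.span_le]
    rintro _ ⟨⟨i, j⟩, rfl⟩
    fin_cases i <;> fin_cases j
    · exact Ideal.subset_span ⟨0, rfl⟩
    · exact Ideal.subset_span ⟨1, rfl⟩
    · exact Ideal.subset_span ⟨1, mul_comm _ _⟩
    · exact Ideal.subset_span ⟨2, rfl⟩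

/-- A syzygy of a pair of generators of `I` comes from an element of `(z : I)`. -/
lemma exists_mem_of_pair_syzygy {z : R} {I J : Ideal R} {a : Fin 2 → R}
    (ha : Ideal.span (Set.range a) = I)
    (hJ : ∀ y, (∀ x ∈ I, x * y ∈ Ideal.span {z}) → y ∈ J) {c : Fin 2 → R}
    (hc : c 0 * a 0 + c 1 * a 1 = z) (p q : R) (hpq : p * a 0 + q * a 1 = 0) :
    ∃ h ∈ J, h * a 1 = z * p ∧ h * a 0 = -(z * q) := by
  have h1 : (c 1 * p - c 0 * q) * a 1 = z * p := by
    linear_combination p * hc - c 0 * hpq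
  have h0 : (c 1 * p - c 0 * q) * a 0 = -(z * q) := by
    linear_combination c 1 * hpq - q * hc
  refine ⟨c 1 * p - c 0 * q, hJ _ fun x hx => ?_, h1, h0⟩
  rw [← ha] at hx
  obtain ⟨α, hα⟩ := (Submodule.mem_span_range_iff_exists_fun R).mp hx
  rw [Fin.sum_univ_two, smul_eq_mul, smul_eq_mul] at hα
  refine Ideal.mem_span_singleton.mpr ⟨α 1 * p - α 0 * q, ?_⟩
  linear_combination (-(c 1 * p - c 0 * q)) * hα + α 1 * h1 + α 0 * h0

lemma mem_mul_self_of_mul_mem {z : R} (hz : z ∈ nonZeroDivisors R) {I J : Ideal R}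
    {a : Fin 2 → R} (ha : Ideal.span (Set.range a) = I) (hzI : z ∈ I)
    (hJ : ∀ y, (∀ x ∈ I, x * y ∈ Ideal.span {z}) → y ∈ J) (hs : SyzCond a J) (y : R)
    (hy : ∀ x ∈ I, ∃ g ∈ J, y * x = z * g) : y ∈ J * J := by
  have haI : ∀ i, a i ∈ I := fun i => ha ▸ Ideal.subset_span ⟨i, rfl⟩
  obtain ⟨c, hc⟩ := (Submodule.mem_span_range_iff_exists_fun R).mp
    (show z ∈ Ideal.span (Set.range a) from ha.symm ▸ hzI)
  rw [Fin.sum_univ_two, smul_eq_mul, smul_eq_mul] at hc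
  obtain ⟨g0, hg0, h0⟩ := hy _ (haI 0)
  obtain ⟨g1, hg1, h1⟩ := hy _ (haI 1)
  have hrel : a 0 * g1 + a 1 * -g0 = 0 := by
    apply (mul_right_mem_nonZeroDivisors_eq_zero_iff hz).mp
    linear_combination a 1 * h0 - a 0 * h1
  obtain ⟨k, p, h, hh, hg, hp⟩ := hs ![g1, -g0]
    (by intro i; fin_cases i
        · exact hg1
        · exact J.neg_mem hg0)
    (by simpa [Fin.sum_univ_two] using hrel)
  have hg1' : g1 = ∑ κ, p 0 κ * h κ := hg 0
  have hg0' : -g0 = ∑ κ, p 1 κ * h κ := hg 1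
  choose m hmJ hm1 hm0 using fun κ => exists_mem_of_pair_syzygy ha hJ hc (p 0 κ) (p 1 κ)
    (by simpa [Fin.sum_univ_two] using hp κ)
  have e1 : (∑ κ, m κ * h κ) * a 1 = y * a 1 := by
    rw [h1, hg1', Finset.sum_mul, Finset.mul_sum]
    exact Finset.sum_congr rfl fun κ _ => by linear_combination h κ * hm1 κ
  have e0 : (∑ κ, m κ * h κ) * a 0 = y * a 0 := by
    rw [h0, ← neg_neg g0, hg0', mul_neg, Finset.sum_mul, Finset.mul_sum, ← Finset.sum_neg_distrib]
    exact Finset.sum_congr rfl fun κ _ => by linear_combination h κ * hm0 κ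
  have : (∑ κ, m κ * h κ) - y = 0 := by
    apply (mul_right_mem_nonZeroDivisors_eq_zero_iff hz).mp
    rw [← hc]
    linear_combination c 0 * e0 + c 1 * e1
  rw [← sub_eq_zero.mp this]
  exact Ideal.sum_mem _ fun κ _ => Ideal.mul_mem_mul (hmJ κ) (hh κ)

end Syzygies

section LocalTheorem

open IsLocalRing

variable {R : Type*} [CommRing R] [IsLocalRing R]

lemma exists_isMinGen_of_relations {ι : Type*} [Fintype ι] {g : ι → R} {N : Ideal R}
    (hg : Ideal.span (Set.range g) = N)
    (h : ∀ c : ι → R, ∑ i, c i * g i = 0 → ∀ i, c i ∈ maximalIdeal R) :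
    ∃ g' : Fin (Fintype.card ι) → R, IsMinGen g' N := by
  let ε := (Fintype.equivFin ι).symm
  refine ⟨g ∘ ε, .of_relations (by rw [EquivLike.range_comp]; exact hg) fun c hc i => ?_⟩
  have := h (c ∘ ε.symm) (by
    rw [← Equiv.sum_comp ε]; simpa using hc) (ε i)
  simpa using this

/-- Products of minimal generators of `I` and `J` satisfy only relations with coefficients in the
maximal ideal, provided that `I ⊗ J → R` is injective. -/
lemma coeff_mem_of_mul_relation {r s : ℕ} {a : Fin r → R} {b : Fin s → R} {I J : Ideal R}
    (ha : IsMinGen a I) (hb : IsMinGen b J) (hs : SyzCond a J) (c : Fin r → Fin s → R)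
    (hc : ∑ i, a i * ∑ j, c i j * b j = 0) : ∀ i j, c i j ∈ maximalIdeal R := by
  obtain ⟨k, p, h, hh, hg, hp⟩ := hs (fun i => ∑ j, c i j * b j)
    (fun i => Ideal.sum_mem _ fun j _ => Ideal.mul_mem_left _ _ (hb.mem j)) hc
  intro i j
  refine hb.coeff_mem (c i) ?_ j
  rw [hg i]
  refine Ideal.sum_mem _ fun κ _ => Ideal.mul_mem_mul ?_ (hh κ)
  exact ha.coeff_mem (fun i => p i κ) (by rw [hp κ]; exact Ideal.zero_mem _) i

lemma exists_isMinGen_mul {r s : ℕ} {a : Fin r → R} {b : Fin s → R} {I J : Ideal R}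
    (ha : IsMinGen a I) (hb : IsMinGen b J) (hs : SyzCond a J) :
    ∃ g : Fin (r * s) → R, IsMinGen g (I * J) := by
  have h := exists_isMinGen_of_relations (g := fun p : Fin r × Fin s => a p.1 * b p.2)
    (N := I * J) (by rw [span_range_mul, ha.span_eq, hb.span_eq]) (fun c hc => by
      rintro ⟨i, j⟩
      refine coeff_mem_of_mul_relation ha hb hs (fun i j => c (i, j)) ?_ i j
      rw [← hc, Fintype.sum_prod_type]
      refine Finset.sum_congr rfl fun i _ => ?_
      rw [Finset.mul_sum]
      exact Finset.sum_congr rfl fun j _ => by ring)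
  rwa [Fintype.card_prod, Fintype.card_fin, Fintype.card_fin] at h

lemma exists_isMinGen_sq_mul {s : ℕ} {a : Fin 2 → R} {b : Fin s → R} {I J : Ideal R} {z : R}
    (hz : z ∈ nonZeroDivisors R) (hzI : z ∈ I) (hIJ : ∀ x ∈ I, ∀ y ∈ J, x * y ∈ Ideal.span {z})
    (hJ : ∀ y, (∀ x ∈ I, x * y ∈ Ideal.span {z}) → y ∈ J)
    (ha : IsMinGen a I) (hb : IsMinGen b J) (hs : SyzCond a J) :
    ∃ g : Fin (3 * s) → R, IsMinGen g (I * I * J) := by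
  obtain ⟨c, hc⟩ := ha.mem_iff.mp hzI
  rw [Fin.sum_univ_two] at hc
  have h := exists_isMinGen_of_relations
    (g := fun p : Fin 3 × Fin s => ![a 0 * a 0, a 0 * a 1, a 1 * a 1] p.1 * b p.2)
    (N := I * I * J) (by
      rw [span_range_mul (![a 0 * a 0, a 0 * a 1, a 1 * a 1]) b, span_range_pair_sq, ha.span_eq,
        hb.span_eq])
    (fun C hC => by
      rw [Fintype.sum_prod_type, Fin.sum_univ_three] at hC
      simp only [Matrix.cons_val_zero, Matrix.cons_val_one, Matrix.cons_val] at hC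
      have hmem : ∀ C' : Fin s → R, ∑ j, C' j * b j ∈ J := fun C' =>
        Ideal.sum_mem _ fun j _ => Ideal.mul_mem_left _ _ (hb.mem j)
      obtain ⟨u, hu⟩ := Ideal.mem_span_singleton.mp (Ideal.add_mem _
        (hIJ _ (ha.mem 0) _ (hmem fun j => C (0, j))) (hIJ _ (ha.mem 1) _ (hmem fun j => C (1, j))))
      obtain ⟨v, hv⟩ := Ideal.mem_span_singleton.mp (hIJ _ (ha.mem 1) _ (hmem fun j => C (2, j)))
      have huv : u * a 0 + v * a 1 = 0 := by
        apply (mul_right_mem_nonZeroDivisors_eq_zero_iff hz).mp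
        rw [← hC]
        simp only [mul_assoc, mul_left_comm (C _)]
        simp only [← Finset.mul_sum]
        linear_combination (-a 0) * hu - a 1 * hv
      obtain ⟨h, hhJ, h1, h0⟩ := exists_mem_of_pair_syzygy ha.span_eq hJ hc u v huv
      obtain ⟨η, hη⟩ := hb.mem_iff.mp hhJ
      have key1 := coeff_mem_of_mul_relation ha hb hs
        ![fun j => C (0, j), fun j => C (1, j) - η j] (by
          simp only [Fin.sum_univ_two, Matrix.cons_val_zero, Matrix.cons_val_one, sub_mul,
            Finset.sum_sub_distrib, hη]
          linear_combination hu - h1)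
      have key2 := coeff_mem_of_mul_relation ha hb hs
        ![fun j => η j, fun j => C (2, j)] (by
          simp only [Fin.sum_univ_two, Matrix.cons_val_zero, Matrix.cons_val_one, hη]
          linear_combination hv + h0)
      rintro ⟨i, j⟩
      fin_cases i
      · exact key1 0 j
      · have h3 := Ideal.add_mem _ (key1 1 j) (key2 0 j)
        simpa using h3
      · exact key2 1 j)
  rwa [Fintype.card_prod, Fintype.card_fin, Fintype.card_fin] at h

end LocalTheorem

section LocalTheorem

open IsLocalRing

variable {R : Type*} [CommRing R] [IsLocalRing R]

lemma map_pi_le {d : ℕ} {φ : (Fin d → R) →ₗ[R] (Fin d → R)}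
    (hφ : ∀ N : Ideal R, ∀ c, (∀ i, c i ∈ N) → ∀ i, φ c i ∈ maximalIdeal R * N) (N : Ideal R) :
    (Submodule.pi Set.univ fun _ : Fin d => N).map φ ≤
      Submodule.pi Set.univ fun _ : Fin d => maximalIdeal R * N := by
  rintro _ ⟨c, hc, rfl⟩ i _
  exact hφ N c (fun i => hc i trivial) i

lemma natCast_le_of_mul_le {d a b : ℕ} (hd : 0 < d) {t : ℕ∞} (ht : t ≠ ⊤)
    (h : d * t + d * (a : ℕ∞) ≤ d * ((b : ℕ∞) + t)) : a ≤ b := by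
  lift t to ℕ using ht
  norm_cast at h
  rw [← mul_add, add_comm] at h
  exact Nat.le_of_add_le_add_right (Nat.le_of_mul_le_mul_left h hd)

lemma IsMinGen.natCast_le {d e l : ℕ} {φ : (Fin d → R) →ₗ[R] (Fin d → R)} (hd : 0 < d)
    (hinj : Function.Injective φ)
    (hφ : ∀ N : Ideal R, ∀ c, (∀ i, c i ∈ N) → ∀ i, φ c i ∈ maximalIdeal R * N)
    (hcol : colength (LinearMap.range φ) = d * e) {N : Ideal R} {g : Fin l → R}
    (hg : IsMinGen g N) (hN : colength N ≠ ⊤) : l ≤ e := by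
  have h := colength_anti (map_pi_le hφ N)
  rw [colength_map_of_injective φ hinj, colength_pi, colength_pi, hg.colength_mul, hcol,
    ← mul_add] at h
  refine natCast_le_of_mul_le hd hN ?_
  rwa [← mul_add, add_comm, add_comm (e : ℕ∞)]

lemma IsMinGen.exists_preimage {d e : ℕ} {φ : (Fin d → R) →ₗ[R] (Fin d → R)}
    (hinj : Function.Injective φ)
    (hφ : ∀ N : Ideal R, ∀ c, (∀ i, c i ∈ N) → ∀ i, φ c i ∈ maximalIdeal R * N)
    (hcol : colength (LinearMap.range φ) = d * e) {N : Ideal R} {g : Fin e → R}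
    (hg : IsMinGen g N) (hN : colength N ≠ ⊤) (c : Fin d → R)
    (hc : ∀ i, c i ∈ maximalIdeal R * N) : ∃ v : Fin d → R, (∀ i, v i ∈ N) ∧ φ v = c := by
  have h := eq_of_colength_le (map_pi_le hφ N)
    (by
      rw [colength_pi, hg.colength_mul]
      exact WithTop.mul_ne_top (ENat.natCast_ne_top d)
        (WithTop.add_ne_top.mpr ⟨ENat.natCast_ne_top e, hN⟩))
    (by
      rw [colength_map_of_injective φ hinj, colength_pi, colength_pi, hg.colength_mul, hcol,
        mul_add, add_comm])
  have hc' : c ∈ Submodule.pi Set.univ fun _ : Fin d => maximalIdeal R * N := fun i _ => hc i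
  rw [← h] at hc'
  obtain ⟨v, hv, rfl⟩ := hc'
  exact ⟨v, fun i => hv i trivial, rfl⟩

lemma le_of_exists_preimage {d e l : ℕ} {φ : (Fin d → R) →ₗ[R] (Fin d → R)} (hd : 0 < d)
    (hinj : Function.Injective φ) (hcol : colength (LinearMap.range φ) = d * e) {N : Ideal R}
    (g : Fin l → R) (hg : Ideal.span (Set.range g) = N) (hN : colength N ≠ ⊤)
    (h : ∀ c : Fin d → R, (∀ i, c i ∈ maximalIdeal R * N) →
      ∃ v : Fin d → R, (∀ i, v i ∈ N) ∧ φ v = c) : e ≤ l := by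
  have hle : (Submodule.pi Set.univ fun _ : Fin d => maximalIdeal R * N) ≤
      (Submodule.pi Set.univ fun _ : Fin d => N).map φ := by
    intro c hc
    obtain ⟨v, hv, rfl⟩ := h c fun i => hc i trivial
    exact ⟨v, fun i _ => hv i, rfl⟩
  have h1 := colength_anti hle
  rw [colength_map_of_injective φ hinj, colength_pi, colength_pi, hcol] at h1
  exact natCast_le_of_mul_le hd hN
    (h1.trans (mul_le_mul_right (colength_maximalIdeal_mul_le g N hg) _))

lemma colength_ne_top_of_pow_le [IsNoetherianRing R] {N : Ideal R} {c : ℕ} (h : maximalIdeal R ^ c ≤ N) :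
    colength N ≠ ⊤ :=
  ne_top_of_le_ne_top (colength_maximalIdeal_pow_ne_top c) (colength_anti h)

/-- In multiplicity at most six, a two-generated ideal `I` cannot be part of a pair `(I, J)` of
mutually `z`-dual ideals with `I ⊗ J` torsion-free, unless `J` is principal. -/
lemma not_pair_of_le_six {d e s : ℕ} {φ : (Fin d → R) →ₗ[R] (Fin d → R)} (hd : 0 < d)
    (hinj : Function.Injective φ)
    (hφ : ∀ N : Ideal R, ∀ c, (∀ i, c i ∈ N) → ∀ i, φ c i ∈ maximalIdeal R * N)
    (hcol : colength (LinearMap.range φ) = d * e) (he : e ≤ 6)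
    (hfin : ∀ N : Ideal R, (∃ w ∈ N, w ∈ nonZeroDivisors R) → colength N ≠ ⊤)
    {z : R} (hz : z ∈ nonZeroDivisors R) {I J : Ideal R} (hzI : z ∈ I) (hzJ : z ∈ J)
    (hIJ : ∀ x ∈ I, ∀ y ∈ J, x * y ∈ Ideal.span {z})
    (hJ : ∀ y, (∀ x ∈ I, x * y ∈ Ideal.span {z}) → y ∈ J)
    (hI : ∀ y, (∀ x ∈ J, x * y ∈ Ideal.span {z}) → y ∈ I)
    (hten : Function.Injective (Submodule.mulMap I J)) {a : Fin 2 → R} {b : Fin s → R}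
    (ha : IsMinGen a I) (hb : IsMinGen b J) (hs : 2 ≤ s) : False := by
  have hzII : z * z ∈ I * I := Ideal.mul_mem_mul hzI hzI
  have hzN : z * z * z ∈ I * I * J := Ideal.mul_mem_mul hzII hzJ
  have hNfin : colength (I * I * J) ≠ ⊤ :=
    hfin _ ⟨_, hzN, mul_mem (mul_mem hz hz) hz⟩
  obtain ⟨g, hg⟩ := exists_isMinGen_sq_mul hz hzI hIJ hJ ha hb (syzCond_of_injective hten ha.span_eq)
  have h3s := hg.natCast_le hd hinj hφ hcol hNfin
  obtain rfl : s = 2 := by omega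
  obtain rfl : e = 3 * 2 := by omega
  have hpre := hg.exists_preimage hinj hφ hcol hNfin
  have h63 : 3 * 2 ≤ 3 := by
    refine le_of_exists_preimage hd hinj hcol (N := I * I) ![a 0 * a 0, a 0 * a 1, a 1 * a 1]
      (by rw [span_range_pair_sq, ha.span_eq]) (hfin _ ⟨_, hzII, mul_mem hz hz⟩) fun w hw => ?_
    have hlift : ∀ y ∈ J, ∃ v : Fin d → R, (∀ i, v i ∈ I * I * J) ∧ φ v = y • w := fun y hy =>
      hpre _ fun i => by
        rw [Pi.smul_apply, smul_eq_mul, mul_comm y, ← mul_assoc]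
        exact Ideal.mul_mem_mul (hw i) hy
    have hNz : I * I * J ≤ I * Ideal.span {z} := by
      rw [mul_assoc]
      exact Ideal.mul_mono le_rfl (Ideal.mul_le.mpr hIJ)
    have hdiv : ∀ x ∈ I * I * J, ∃ t ∈ I, x = z * t := fun x hx => by
      obtain ⟨t, ht, rfl⟩ := Ideal.mem_mul_span_singleton.mp (hNz hx)
      exact ⟨t, ht, mul_comm _ _⟩
    obtain ⟨vz, hvz, hvzw⟩ := hlift z hzJ
    choose v hvI hv using fun i => hdiv _ (hvz i)
    have hvz' : vz = z • v := funext hv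
    have hφv : φ v = w := by
      rw [hvz', map_smul] at hvzw
      funext i
      exact (mul_cancel_left_mem_nonZeroDivisors hz).mp (congrFun hvzw i)
    refine ⟨v, fun i => ?_, hφv⟩
    refine mem_mul_self_of_mul_mem hz hb.span_eq hzJ hI
      (syzCond_of_injective (injective_mulMap_comm hten) hb.span_eq) _ fun y hy => ?_
    obtain ⟨vy, hvy, hvyw⟩ := hlift y hy
    have : y • v = vy := hinj (by rw [map_smul, hφv, hvyw])
    obtain ⟨t, ht, h⟩ := hdiv _ (hvy i)
    refine ⟨t, ht, ?_⟩
    rw [← h, ← this, Pi.smul_apply, smul_eq_mul, mul_comm]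
  omega

/-- The one-dimensional local theorem. -/
theorem mem_mul_of_multiplicity_le_six [IsNoetherianRing R] {e N₀ : ℕ} (he6 : e ≤ 6) (he : ∀ n ≥ N₀,
      colength (maximalIdeal R ^ (n + 1)) = colength (maximalIdeal R ^ n) + e)
    (hprim : ∀ w ∈ nonZeroDivisors R, ∃ c, maximalIdeal R ^ c ≤ Ideal.span {w})
    {z : R} (hzm : z ∈ maximalIdeal R) (hz : z ∈ nonZeroDivisors R) {I J : Ideal R}
    (hzI : z ∈ I) (hzJ : z ∈ J) (hIJ : ∀ x ∈ I, ∀ y ∈ J, x * y ∈ Ideal.span {z})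
    (hJ : ∀ y, (∀ x ∈ I, x * y ∈ Ideal.span {z}) → y ∈ J)
    (hI : ∀ y, (∀ x ∈ J, x * y ∈ Ideal.span {z}) → y ∈ I)
    (hten : Function.Injective (Submodule.mulMap I J)) : z ∈ I * J := by
  obtain ⟨d, φ, hd, hinj, hφ, hcol⟩ := exists_matrix_reduction hzm hz e N₀ he
  have hfin : ∀ N : Ideal R, (∃ w ∈ N, w ∈ nonZeroDivisors R) → colength N ≠ ⊤ := by
    rintro N ⟨w, hwN, hw⟩
    obtain ⟨c, hc⟩ := hprim w hw
    exact colength_ne_top_of_pow_le (hc.trans ((Ideal.span_singleton_le_iff_mem _).mpr hwN))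
  have hprincipal : ∀ {I J : Ideal R} {l : ℕ} {a : Fin l → R}, z ∈ I →
      (∀ y, (∀ x ∈ I, x * y ∈ Ideal.span {z}) → y ∈ J) → IsMinGen a I → l ≤ 1 → z ∈ I * J := by
    intro I J l a hzI hJ ha hl
    obtain ⟨c, hc⟩ := ha.mem_iff.mp hzI
    interval_cases l
    · rw [Fin.sum_univ_zero] at hc
      rw [← hc]
      exact Ideal.zero_mem _
    · rw [Fin.sum_univ_one] at hc
      rw [← hc, mul_comm (c 0)]
      refine Ideal.mul_mem_mul (ha.mem 0) (hJ _ fun x hx => ?_)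
      obtain ⟨t, rfl⟩ := ha.mem_iff.mp hx
      rw [Fin.sum_univ_one, mul_assoc, mul_comm (a 0), hc]
      exact Ideal.mul_mem_left _ _ (Ideal.mem_span_singleton_self z)
  obtain ⟨r, a, ha⟩ := exists_isMinGen I
  obtain ⟨s, b, hb⟩ := exists_isMinGen J
  rcases Nat.lt_or_ge 1 r with hr | hr
  · rcases Nat.lt_or_ge 1 s with hs | hs
    · exfalso
      obtain ⟨g, hg⟩ := exists_isMinGen_mul ha hb (syzCond_of_injective hten ha.span_eq)
      have hrs := hg.natCast_le hd hinj hφ hcol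
        (hfin _ ⟨z * z, Ideal.mul_mem_mul hzI hzJ, mul_mem hz hz⟩)
      have h2 : r = 2 ∨ s = 2 := by
        by_contra! hcon
        have : 3 * 3 ≤ r * s := Nat.mul_le_mul (by omega) (by omega)
        omega
      rcases h2 with rfl | rfl
      · exact not_pair_of_le_six hd hinj hφ hcol he6 hfin hz hzI hzJ hIJ hJ hI hten ha hb hs
      · exact not_pair_of_le_six hd hinj hφ hcol he6 hfin hz hzJ hzI
          (fun x hx y hy => by rw [mul_comm]; exact hIJ y hy x hx) hI hJ
          (injective_mulMap_comm hten) hb ha hr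
    · rw [mul_comm]
      exact hprincipal hzJ hI hb hs
  · exact hprincipal hzI hJ ha hr

end LocalTheorem

section DoubleAnnihilator

open IsLocalRing

/-- The colon ideal `(z : N)`. -/
def dualIdeal {R : Type*} [CommRing R] (z : R) (N : Ideal R) : Ideal R where
  carrier := {y | ∀ x ∈ N, x * y ∈ Ideal.span {z}}
  add_mem' := fun {a b} ha hb x hx => by
    rw [mul_add]; exact Ideal.add_mem _ (ha x hx) (hb x hx)
  zero_mem' := fun x _ => by rw [mul_zero]; exact Ideal.zero_mem _
  smul_mem' := fun c v hv x hx => by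
    rw [smul_eq_mul, mul_left_comm]; exact Ideal.mul_mem_left _ _ (hv x hx)

variable {R : Type*} [CommRing R]

lemma mem_dualIdeal {z : R} {N : Ideal R} {y : R} :
    y ∈ dualIdeal z N ↔ ∀ x ∈ N, x * y ∈ Ideal.span {z} := Iff.rfl

lemma dualIdeal_anti {z : R} {N N' : Ideal R} (h : N ≤ N') : dualIdeal z N' ≤ dualIdeal z N :=
  fun _ hy x hx => hy x (h hx)

lemma le_dualIdeal_dualIdeal (z : R) (N : Ideal R) : N ≤ dualIdeal z (dualIdeal z N) :=
  fun y hy x hx => by rw [mul_comm]; exact hx y hy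

lemma dualIdeal_dualIdeal_dualIdeal (z : R) (N : Ideal R) :
    dualIdeal z (dualIdeal z (dualIdeal z N)) = dualIdeal z N :=
  le_antisymm (dualIdeal_anti (le_dualIdeal_dualIdeal z N)) (le_dualIdeal_dualIdeal z _)

lemma mem_dualIdeal_self (z : R) (N : Ideal R) : z ∈ dualIdeal z N :=
  fun _ _ => Ideal.mul_mem_left _ _ (Ideal.mem_span_singleton_self z)

lemma dualIdeal_top (z : R) : dualIdeal z ⊤ = Ideal.span {z} := by
  refine le_antisymm (fun y hy => ?_) ((Ideal.span_singleton_le_iff_mem _).mpr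
    (mem_dualIdeal_self z _))
  simpa using hy 1 trivial

lemma dualIdeal_span_self (z : R) : dualIdeal z (Ideal.span {z}) = ⊤ :=
  eq_top_iff.mpr fun _ _ _ hx => Ideal.mul_mem_right _ _ hx

variable [IsLocalRing R]

lemma colength_le_add_one {A B : Ideal R} (hAB : A ≤ B) {c : R} (hc : c ∈ B)
    (hB : ∀ y ∈ B, ∃ r, y - r * c ∈ A) (hm : ∀ x ∈ maximalIdeal R, x * c ∈ A) :
    colength A ≤ colength B + 1 := by
  rw [colength_eq_of_le hAB, add_comm]
  gcongr
  have hsimple : IsSimpleModule R (R ⧸ maximalIdeal R) :=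
    (isSimpleModule_iff_isCoatom).mpr (Ideal.isMaximal_def.mp inferInstance)
  rw [← Module.length_eq_one R (R ⧸ maximalIdeal R)]
  let f : R →ₗ[R] (R ⧸ A) := LinearMap.toSpanSingleton R _ (Submodule.Quotient.mk c)
  have hf : ∀ r, f r = Submodule.Quotient.mk (r * c) := fun r => rfl
  let f' : R →ₗ[R] LinearMap.ker (Submodule.factor hAB) := f.codRestrict _ fun r => by
    rw [LinearMap.mem_ker, hf]
    exact (Submodule.Quotient.mk_eq_zero B).mpr (Ideal.mul_mem_left _ _ hc)
  have hker : maximalIdeal R ≤ LinearMap.ker f' := by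
    intro x hx
    rw [LinearMap.mem_ker]
    apply Subtype.ext
    change f x = 0
    rw [hf]
    exact (Submodule.Quotient.mk_eq_zero A).mpr (hm x hx)
  refine Module.length_le_of_surjective (Submodule.liftQ _ f' hker) ?_
  rintro ⟨q, hq⟩
  obtain ⟨y, rfl⟩ := Submodule.mkQ_surjective _ q
  have hy : y ∈ B := (Submodule.Quotient.mk_eq_zero B).mp hq
  obtain ⟨r, hr⟩ := hB y hy
  refine ⟨Submodule.Quotient.mk r, Subtype.ext ?_⟩
  change f r = _
  rw [hf]
  exact ((Submodule.Quotient.eq A).mpr hr).symm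

lemma exists_socle_mem {N' N : Ideal R} (hle : N' < N) {c : ℕ} (hc : maximalIdeal R ^ c ≤ N') :
    ∃ x ∈ N, x ∉ N' ∧ ∀ t ∈ maximalIdeal R, t * x ∈ N' := by
  obtain ⟨-, y, hyN, hyN'⟩ := SetLike.lt_iff_le_and_exists.mp hle
  have key : ∀ c : ℕ, ∀ y ∈ N, y ∉ N' → (∀ t ∈ maximalIdeal R ^ c, t * y ∈ N') →
      ∃ x ∈ N, x ∉ N' ∧ ∀ t ∈ maximalIdeal R, t * x ∈ N' := by
    intro c
    induction c with
    | zero =>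
      intro y _ hy h
      exact absurd (by simpa using h 1 (by simp)) hy
    | succ c ih =>
      intro y hyN hy h
      by_cases hall : ∀ t ∈ maximalIdeal R, t * y ∈ N'
      · exact ⟨y, hyN, hy, hall⟩
      · push Not at hall
        obtain ⟨t, ht, hty⟩ := hall
        refine ih (t * y) (Ideal.mul_mem_left _ _ hyN) hty fun s hs => ?_
        rw [← mul_assoc]
        exact h _ (by rw [pow_succ]; exact Ideal.mul_mem_mul hs ht)
  exact key c y hyN hyN' fun t ht => Ideal.mul_mem_right _ _ (hc ht)

variable [IsNoetherianRing R]

lemma colength_add_colength_dualIdeal_mono {z : R}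
    (hsoc : ∀ σ τ : R, (∀ x ∈ maximalIdeal R, x * σ ∈ Ideal.span {z}) →
      (∀ x ∈ maximalIdeal R, x * τ ∈ Ideal.span {z}) →
      σ ∈ Ideal.span {z} ∨ ∃ r, τ - r * σ ∈ Ideal.span {z})
    {c : ℕ} (N N' : Ideal R) (hc : maximalIdeal R ^ c ≤ N') (h : N' ≤ N) :
    colength N + colength (dualIdeal z N) ≤ colength N' + colength (dualIdeal z N') := by
  induction N' using WellFoundedGT.induction with
  | ind N' ih =>
  rcases h.eq_or_lt with rfl | hlt
  · exact le_rfl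
  obtain ⟨x, hxN, hxN', hx⟩ := exists_socle_mem hlt hc
  have hlt' : N' < N' ⊔ Ideal.span {x} :=
    left_lt_sup.mpr fun h => hxN' (h (Ideal.mem_span_singleton_self x))
  refine (ih _ hlt' (hc.trans le_sup_left)
    (sup_le h ((Ideal.span_singleton_le_iff_mem _).mpr hxN))).trans ?_
  have h1 : colength (N' ⊔ Ideal.span {x}) + 1 ≤ colength N' := by
    have hne := colength_ne_top_of_pow_le (hc.trans hlt'.le)
    rw [ENat.add_one_le_iff hne]
    by_contra! hcon
    exact hlt'.ne (eq_of_colength_le hlt'.le hne hcon)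
  have hmemsup : ∀ y, y ∈ dualIdeal z N' → x * y ∈ Ideal.span {z} →
      y ∈ dualIdeal z (N' ⊔ Ideal.span {x}) := by
    intro y hy hxy w hw
    obtain ⟨a, ha, b, hb, rfl⟩ := Submodule.mem_sup.mp hw
    obtain ⟨t, rfl⟩ := Ideal.mem_span_singleton.mp hb
    rw [add_mul]
    refine Ideal.add_mem _ (hy a ha) ?_
    rw [mul_right_comm]
    exact Ideal.mul_mem_right _ _ hxy
  have h2 : colength (dualIdeal z (N' ⊔ Ideal.span {x})) ≤ colength (dualIdeal z N') + 1 := by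
    have hanti := dualIdeal_anti (z := z) hlt'.le
    by_cases hall : ∀ y ∈ dualIdeal z N', x * y ∈ Ideal.span {z}
    · rw [le_antisymm hanti fun y hy => hmemsup y hy (hall y hy)]
      exact le_self_add
    · push Not at hall
      obtain ⟨c₀, hc₀, hxc⟩ := hall
      have hsocle : ∀ y ∈ dualIdeal z N', ∀ t ∈ maximalIdeal R,
          t * (x * y) ∈ Ideal.span {z} := fun y hy t ht => by
        rw [← mul_assoc]; exact hy _ (hx t ht)
      refine colength_le_add_one hanti hc₀ (fun y hy => ?_) fun t ht => ?_
      · rcases hsoc _ _ (hsocle c₀ hc₀) (hsocle y hy) with h | ⟨r, hr⟩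
        · exact absurd h hxc
        · refine ⟨r, hmemsup _ (Ideal.sub_mem _ hy (Ideal.mul_mem_left _ _ hc₀)) ?_⟩
          rwa [mul_sub, mul_left_comm]
      · refine hmemsup _ (Ideal.mul_mem_left _ _ hc₀) ?_
        rw [mul_left_comm]
        exact hsocle c₀ hc₀ t ht
  calc _ ≤ colength (N' ⊔ Ideal.span {x}) + (colength (dualIdeal z N') + 1) := by gcongr
    _ = (colength (N' ⊔ Ideal.span {x}) + 1) + colength (dualIdeal z N') := by ring
    _ ≤ _ := by gcongr

/-- If `R / z` has finite length and a simple socle, then every ideal containing `z` is its own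
double dual. -/
theorem dualIdeal_dualIdeal_of_socle {z : R}
    (hsoc : ∀ σ τ : R, (∀ x ∈ maximalIdeal R, x * σ ∈ Ideal.span {z}) →
      (∀ x ∈ maximalIdeal R, x * τ ∈ Ideal.span {z}) →
      σ ∈ Ideal.span {z} ∨ ∃ r, τ - r * σ ∈ Ideal.span {z})
    {c : ℕ} (hc : maximalIdeal R ^ c ≤ Ideal.span {z}) (N : Ideal R) (hN : z ∈ N) :
    dualIdeal z (dualIdeal z N) = N := by
  have hconst : ∀ N : Ideal R, z ∈ N →
      colength N + colength (dualIdeal z N) = colength (Ideal.span {z}) := by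
    intro N hN
    have hzN := (Ideal.span_singleton_le_iff_mem _).mpr hN
    apply le_antisymm
    · have h := colength_add_colength_dualIdeal_mono hsoc N _ hc hzN
      rwa [dualIdeal_span_self, colength_top, add_zero] at h
    · have h := colength_add_colength_dualIdeal_mono hsoc ⊤ N (hc.trans hzN) le_top
      rwa [dualIdeal_top, colength_top, zero_add] at h
  have hle := le_dualIdeal_dualIdeal z N
  have h1 := hconst _ hN
  have h2 := hconst _ (hle hN)
  rw [dualIdeal_dualIdeal_dualIdeal, ← h1] at h2
  have hfin : ∀ N : Ideal R, z ∈ N → colength N ≠ ⊤ := fun N hN =>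
    colength_ne_top_of_pow_le (hc.trans ((Ideal.span_singleton_le_iff_mem _).mpr hN))
  exact (eq_of_colength_le hle (hfin _ (hle hN))
    (WithTop.add_right_cancel (hfin _ (mem_dualIdeal_self z N)) h2).ge).symm

end DoubleAnnihilator

section ExtComputation

variable {R : Type u} [CommRing R]

lemma boundary_or_boundary_of_homology_iso (S : ShortComplex (ModuleCat.{u} R)) {m : Ideal R}
    (hm : m.IsMaximal) (e : S.homology ≅ ModuleCat.of R (R ⧸ m)) (u w : S.X₂) (hu : S.g u = 0)
    (hw : S.g w = 0) : (∃ v, S.f v = u) ∨ ∃ (r : R) (v : S.X₁), S.f v = w - r • u := by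
  let φ : (LinearMap.ker S.g.hom ⧸ LinearMap.range S.moduleCatToCycles) ≃ₗ[R] (R ⧸ m) :=
    (S.moduleCatHomologyIso.symm ≪≫ e).toLinearEquiv
  let u' : LinearMap.ker S.g.hom := ⟨u, hu⟩
  let w' : LinearMap.ker S.g.hom := ⟨w, hw⟩
  let π := (LinearMap.range S.moduleCatToCycles).mkQ
  have key : ∀ t : LinearMap.ker S.g.hom, φ (π t) = 0 → ∃ v, S.f v = t.1 := by
    intro t ht
    have h0 : π t = 0 := (LinearEquiv.map_eq_zero_iff φ).mp ht
    obtain ⟨v, hv⟩ := (Submodule.Quotient.mk_eq_zero _).mp h0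
    exact ⟨v, congrArg Subtype.val hv⟩
  obtain ⟨α, hα⟩ := Ideal.Quotient.mk_surjective (φ (π u'))
  obtain ⟨β, hβ⟩ := Ideal.Quotient.mk_surjective (φ (π w'))
  by_cases h : α ∈ m
  · exact Or.inl (key u' (by rw [← hα]; exact Ideal.Quotient.eq_zero_iff_mem.mpr h))
  · right
    obtain ⟨s, hs⟩ := hm.exists_inv h
    obtain ⟨i, hi, his⟩ := hs
    refine ⟨β * s, ?_⟩
    obtain ⟨v, hv⟩ := key (w' - (β * s) • u') (by
      rw [map_sub, map_sub, map_smul, map_smul, ← hα, ← hβ, ← Ideal.Quotient.mk_eq_mk,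
        ← Ideal.Quotient.mk_eq_mk, ← Submodule.Quotient.mk_smul, ← Submodule.Quotient.mk_sub]
      refine (Submodule.Quotient.mk_eq_zero _).mpr ?_
      have : β - (β * s) • α = β * i := by rw [smul_eq_mul]; linear_combination (-β) * his
      rw [this]
      exact Ideal.mul_mem_left _ _ hi)
    exact ⟨v, hv⟩

lemma subsingleton_abelianExt {X Y : ModuleCat.{u} R} {n : ℕ}
    (h : Subsingleton (((Ext R (ModuleCat.{u} R) n).obj (Opposite.op X)).obj Y)) :
    Subsingleton (Abelian.Ext.{u} X Y n) := by
  let P := ProjectiveResolution.of X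
  let K := P.complex.linearYonedaObj R Y
  have hK : Subsingleton (K.homology n) :=
    (P.isoExt n Y : _ ≅ K.homology n).toLinearEquiv.symm.toEquiv.subsingleton
  have hex : ∀ f : P.complex.X n ⟶ Y, P.complex.d (n + 1) n ≫ f = 0 →
      ∀ p, (ComplexShape.up ℕ).prev n = p → ∃ g : P.complex.X p ⟶ Y, P.complex.d n p ≫ g = f := by
    intro f hf p hp
    have := ((K.exactAt_iff' p n (n + 1) hp (by simp)).mp
      ((K.exactAt_iff_isZero_homology n).mpr (ModuleCat.isZero_of_subsingleton _)))
    exact (ShortComplex.moduleCat_exact_iff _).mp this f hf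
  have h0 : ∀ α : Abelian.Ext.{u} X Y n, α = 0 := by
    intro α
    obtain ⟨f, hf, rfl⟩ := P.extMk_surjective α (n + 1) rfl
    cases n with
    | zero =>
      obtain ⟨g, hg⟩ := hex f hf 0 (by simp)
      have : f = 0 := by rw [← hg, P.complex.shape _ _ (by simp), Limits.zero_comp]
      subst this
      simp
    | succ p =>
      exact (P.extMk_eq_zero_iff f _ rfl hf p rfl).mpr (hex f hf p (by simp))
  exact ⟨fun a b => (h0 a).trans (h0 b).symm⟩

end ExtComputation

section Socle

variable {R : Type u} [CommRing R]

lemma socle_of_ext_one_iso {m : Ideal R} (hm : m.IsMaximal) {z : R} (hzm : z ∈ m)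
    (hz : z ∈ nonZeroDivisors R)
    (e : ((Ext R (ModuleCat.{u} R) 1).obj (Opposite.op (ModuleCat.of R (R ⧸ m)))).obj
      (ModuleCat.of R R) ≅ ModuleCat.of R (R ⧸ m))
    (σ τ : R) (hσ : ∀ x ∈ m, x * σ ∈ Ideal.span {z}) (hτ : ∀ x ∈ m, x * τ ∈ Ideal.span {z}) :
    σ ∈ Ideal.span {z} ∨ ∃ r, τ - r * σ ∈ Ideal.span {z} := by
  let k := ModuleCat.of R (R ⧸ m)
  let P := ProjectiveResolution.of k
  let A := ModuleCat.of R R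
  let K := P.complex.linearYonedaObj R A
  let ε : P.complex.X 0 ⟶ k := P.π.f 0
  let mk : A ⟶ k := ModuleCat.ofHom m.mkQ
  have hmk : Epi mk := (ModuleCat.epi_iff_surjective _).mpr m.mkQ_surjective
  have hε : Function.Surjective ε := (ModuleCat.epi_iff_surjective ε).mp (inferInstanceAs (Epi (P.π.f 0)))
  let π : P.complex.X 0 ⟶ A := Projective.factorThru ε mk
  have hπ : ∀ p, m.mkQ (π p) = ε p := fun p =>
    congrArg (fun f => f p) (congrArg (fun f => f.hom) (Projective.factorThru_comp ε mk))
  have hexact : ∀ p, ε p = 0 → ∃ q, P.complex.d 1 0 q = p :=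
    (ShortComplex.moduleCat_exact_iff _).mp P.exact₀
  have hcomp : ∀ q, ε (P.complex.d 1 0 q) = 0 := fun q =>
    congrArg (fun f => f.hom q) P.complex_d_comp_π_f_zero
  have hdd : ∀ q, P.complex.d 1 0 (P.complex.d 2 1 q) = 0 := fun q =>
    congrArg (fun f => f.hom q) (P.complex.d_comp_d 2 1 0)
  have hz0 : ∀ {a : R}, z * a = 0 → a = 0 := fun {a} h =>
    (mul_left_mem_nonZeroDivisors_eq_zero_iff hz).mp h
  have lift : ∀ σ, (∀ x ∈ m, x * σ ∈ Ideal.span {z}) → ∃ h : P.complex.X 1 ⟶ A,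
      (∀ q, z * h q = σ * π (P.complex.d 1 0 q)) ∧ P.complex.d 2 1 ≫ h = 0 := by
    intro σ hσ
    let zmap : A ⟶ ModuleCat.of R (Ideal.span {z} : Ideal R) :=
      ModuleCat.ofHom (LinearMap.toSpanSingleton R (Ideal.span {z} : Ideal R)
        ⟨z, Ideal.mem_span_singleton_self z⟩)
    have : Epi zmap := (ModuleCat.epi_iff_surjective _).mpr (by
      rintro ⟨y, hy⟩
      obtain ⟨a, rfl⟩ := Ideal.mem_span_singleton'.mp hy
      exact ⟨a, rfl⟩)
    let g : P.complex.X 1 ⟶ ModuleCat.of R (Ideal.span {z} : Ideal R) :=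
      ModuleCat.ofHom (LinearMap.codRestrict (Ideal.span {z} : Ideal R)
        (σ • (P.complex.d 1 0 ≫ π).hom) (fun q => by
          have h1 : π (P.complex.d 1 0 q) ∈ m := by
            rw [← Submodule.Quotient.mk_eq_zero]
            exact (hπ _).trans (hcomp q)
          have := hσ _ h1
          rw [mul_comm] at this
          exact this))
    have hfac : ∀ q, zmap (Projective.factorThru g zmap q) = g q := fun q =>
      congrArg (fun f => f.hom q) (Projective.factorThru_comp g zmap)
    have h1 : ∀ q, z * (Projective.factorThru g zmap q : R) = σ * π (P.complex.d 1 0 q) := by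
      intro q
      have := congrArg Subtype.val (hfac q)
      rw [mul_comm]
      exact this
    refine ⟨Projective.factorThru g zmap, h1, ?_⟩
    ext q
    refine hz0 ((h1 (P.complex.d 2 1 q)).trans ?_)
    rw [hdd, map_zero, mul_zero]
  have bdry : ∀ (σ : R) (h : P.complex.X 1 ⟶ A) (g : P.complex.X 0 ⟶ A),
      (∀ x ∈ m, x * σ ∈ Ideal.span {z}) →
      (∀ q, z * h q = σ * π (P.complex.d 1 0 q)) → (∀ q, g (P.complex.d 1 0 q) = h q) →
      σ ∈ Ideal.span {z} := by
    intro σ h g hσ hh hg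
    obtain ⟨p, hp⟩ := hε (m.mkQ 1)
    obtain ⟨q, hq⟩ := hexact (z • p) (by
      rw [map_smul, hp, ← map_smul]
      exact (Submodule.Quotient.mk_eq_zero _).mpr (by simpa using hzm))
    have h1 : z * (z * g p) = z * (σ * π p) := by
      have h2 := hh q
      rw [← hg, hq, map_smul, map_smul, smul_eq_mul, smul_eq_mul] at h2
      rw [h2]; ring
    have h3 : z * g p = σ * π p := by
      have := hz0 (a := z * g p - σ * π p) (by rw [mul_sub, h1, sub_self])
      exact sub_eq_zero.mp this
    have h4 : π p - 1 ∈ m := by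
      rw [← Submodule.Quotient.mk_eq_zero, Submodule.Quotient.mk_sub, sub_eq_zero]
      exact (hπ p).trans hp
    have h5 := hσ _ h4
    have h6 : σ = z * g p - (π p - 1) * σ := by rw [h3]; ring
    rw [h6]
    exact Ideal.sub_mem _ (Ideal.mul_mem_right _ _ (Ideal.mem_span_singleton_self z)) h5
  obtain ⟨hs, hs1, hs2⟩ := lift σ hσ
  obtain ⟨ht, ht1, ht2⟩ := lift τ hτ
  let eiso : (K.sc' 0 1 2).homology ≅ k :=
    (ShortComplex.homologyMapIso (K.isoSc' 0 1 2 (by simp) (by simp))).symm ≪≫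
      (P.isoExt 1 A).symm ≪≫ e
  rcases boundary_or_boundary_of_homology_iso (K.sc' 0 1 2) hm eiso hs ht hs2 ht2 with
    ⟨v, hv⟩ | ⟨r, v, hv⟩
  · left
    let v' : P.complex.X 0 ⟶ A := v
    have hv' : P.complex.d 1 0 ≫ v' = hs := hv
    exact bdry σ hs v' hσ hs1 (fun q => congrArg (fun f => f.hom q) hv')
  · right
    let v' : P.complex.X 0 ⟶ A := v
    have hv' : P.complex.d 1 0 ≫ v' = ht - r • hs := hv
    refine ⟨r, bdry (τ - r * σ) (ht - r • hs) v' (fun x hx => ?_) (fun q => ?_)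
      (fun q => congrArg (fun f => f.hom q) hv')⟩
    · rw [mul_sub, mul_left_comm]
      exact Ideal.sub_mem _ (hτ x hx) (Ideal.mul_mem_left _ _ (hσ x hx))
    · change z * (ht q - r * hs q) = _
      linear_combination ht1 q - r * hs1 q

end Socle

section AssociatedPrimes

open IsLocalRing Pointwise

variable {R : Type u} [CommRing R] [IsLocalRing R] [IsNoetherianRing R]

lemma exists_associatedPrime_quotSMulTop_gt {M : Type*} [AddCommGroup M] [Module R M]
    [Module.Finite R M] {x : R} (hxm : x ∈ maximalIdeal R) (hx : IsSMulRegular M x)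
    {P : Ideal R} (hP : IsAssociatedPrime P M) :
    ∃ Q, IsAssociatedPrime Q (QuotSMulTop x M) ∧ P < Q := by
  obtain ⟨hPp, y, hy⟩ := isAssociatedPrime_iff.mp hP
  have hPy : ∀ p, p ∈ P ↔ p • y = 0 := fun p => by
    rw [hy, Submodule.mem_colon_singleton, Submodule.mem_bot]
  have hy0 : y ≠ 0 := fun h => hPp.ne_top ((Ideal.eq_top_iff_one _).mpr ((hPy 1).mpr (by simp [h])))
  have hxP : x ∉ P := fun h => hy0 (hx (by simpa using (hPy x).mp h))
  let U : Submodule R M := Submodule.torsionBySet R M P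
  have hU : ∀ u, u ∈ U ↔ ∀ p ∈ P, p • u = 0 := fun u => by
    rw [Submodule.mem_torsionBySet_iff]
    exact ⟨fun h p hp => h ⟨p, hp⟩, fun h p => h p.1 p.2⟩
  obtain ⟨u, huU, hux⟩ : ∃ u ∈ U, u ∉ x • (⊤ : Submodule R M) := by
    by_contra! hcon
    have hle : U ≤ Ideal.span {x} • U := by
      intro u hu
      obtain ⟨v, -, rfl⟩ := (Submodule.mem_smul_pointwise_iff_exists _ _ _).mp (hcon u hu)
      refine Submodule.smul_mem_smul (Ideal.mem_span_singleton_self x) ((hU v).mpr fun p hp => ?_)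
      refine hx ?_
      change x • p • v = x • 0
      rw [smul_comm, (hU _).mp hu p hp, smul_zero]
    have hbot := Submodule.eq_bot_of_le_smul_of_le_jacobson_bot _ U (IsNoetherian.noetherian U) hle
      (by
        rw [IsLocalRing.jacobson_eq_maximalIdeal _ bot_ne_top, Ideal.span_singleton_le_iff_mem]
        exact hxm)
    have : y ∈ U := (hU y).mpr fun p hp => (hPy p).mp hp
    rw [hbot] at this
    exact hy0 this
  obtain ⟨Q, hQ, hle⟩ := exists_le_isAssociatedPrime_of_isNoetherianRing R
    (Submodule.Quotient.mk u : QuotSMulTop x M)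
    (fun h => hux ((Submodule.Quotient.mk_eq_zero _).mp h))
  have hxQ : x ∈ Q := hle (by
    rw [Submodule.mem_colon_singleton, Submodule.mem_bot, ← Submodule.Quotient.mk_smul,
      Submodule.Quotient.mk_eq_zero]
    exact Submodule.smul_mem_pointwise_smul _ _ _ trivial)
  refine ⟨Q, hQ, lt_of_le_of_ne (fun p hp => hle ?_) (fun h => hxP (h ▸ hxQ))⟩
  rw [Submodule.mem_colon_singleton, Submodule.mem_bot, ← Submodule.Quotient.mk_smul,
    (hU u).mp huU p hp, Submodule.Quotient.mk_zero]

lemma length_le_coheight_of_isAssociatedPrime (rs : List R) (hrs : ∀ r ∈ rs, r ∈ maximalIdeal R)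
    {M : Type u} [AddCommGroup M] [Module R M] [Module.Finite R M]
    (hreg : RingTheory.Sequence.IsWeaklyRegular M rs) {P : Ideal R}
    (hP : IsAssociatedPrime P M) :
    (rs.length : ℕ∞) ≤ Order.coheight (⟨P, hP.isPrime⟩ : PrimeSpectrum R) := by
  induction rs generalizing M P with
  | nil => simp
  | cons r rs ih =>
    rw [RingTheory.Sequence.isWeaklyRegular_cons_iff] at hreg
    obtain ⟨Q, hQ, hPQ⟩ := exists_associatedPrime_quotSMulTop_gt (hrs r (by simp)) hreg.1 hP
    have h1 := ih (fun s hs => hrs s (by simp [hs])) hreg.2 hQ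
    have h2 : (⟨P, hP.isPrime⟩ : PrimeSpectrum R) < ⟨Q, hQ.isPrime⟩ := hPQ
    have h3 := Order.coheight_add_one_le h2
    push_cast [List.length_cons]
    exact (add_le_add_left h1 1).trans h3

lemma height_eq_one_of_isAssociatedPrime_quotSMulTop {d : ℕ} (hd : ringKrullDim R = d)
    (hext : ∀ i < d, Subsingleton (((Ext R (ModuleCat.{u} R) i).obj (Opposite.op
      (ModuleCat.of R (R ⧸ maximalIdeal R)))).obj (ModuleCat.of R R)))
    {z : R} (hz : z ∈ nonZeroDivisors R) {P : Ideal R}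
    (hP : IsAssociatedPrime P (QuotSMulTop z R)) :
    Order.height (⟨P, hP.isPrime⟩ : PrimeSpectrum R) = 1 := by
  have hzreg : IsSMulRegular R z := fun a b h => by
    have h' : z * (a - b) = 0 := by rw [mul_sub]; exact sub_eq_zero.mpr h
    exact sub_eq_zero.mp ((mul_left_mem_nonZeroDivisors_eq_zero_iff hz).mp h')
  let k := ModuleCat.of R (R ⧸ maximalIdeal R)
  let A := ModuleCat.of R R
  have hext' : ∀ i < d - 1, Subsingleton
      (Abelian.Ext.{u} k (ModuleCat.of R (QuotSMulTop z A)) i) := by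
    intro i hi
    have zero1 := AddCommGrpCat.isZero_of_iff_subsingleton.mpr
      (subsingleton_abelianExt (hext i (by omega)))
    have zero2 := AddCommGrpCat.isZero_of_iff_subsingleton.mpr
      (subsingleton_abelianExt (hext (i + 1) (by omega)))
    exact AddCommGrpCat.subsingleton_of_isZero <| ShortComplex.Exact.isZero_of_both_zeros
      ((Abelian.Ext.covariant_sequence_exact₃' k
        (IsSMulRegular.smulShortComplex_shortExact (M := A) hzreg)) i (i + 1) rfl)
      (zero1.eq_zero_of_src _) (zero2.eq_zero_of_tgt _)
  have hPle : P ≤ maximalIdeal R := le_maximalIdeal hP.isPrime.ne_top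
  have hntr : Nontrivial (QuotSMulTop z R) := by
    by_contra h
    rw [not_nontrivial_iff_subsingleton] at h
    exact not_isAssociatedPrime_of_subsingleton hP
  obtain ⟨rs, hlen, hrs, hreg⟩ := ModuleCat.exists_isRegular_of_exists_subsingleton_ext
    (maximalIdeal R) (d - 1) (ModuleCat.of R (QuotSMulTop z A))
    (by
      refine lt_top_iff_ne_top.mpr fun h => ?_
      have := Submodule.eq_bot_of_le_smul_of_le_jacobson_bot (maximalIdeal R)
        (⊤ : Submodule R (QuotSMulTop z R)) (IsNoetherian.noetherian _) h.ge
        (IsLocalRing.jacobson_eq_maximalIdeal _ bot_ne_top).ge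
      exact bot_ne_top this.symm) k
    (by
      change Module.support R (R ⧸ maximalIdeal R) = _
      rw [Module.support_eq_zeroLocus, Ideal.annihilator_quotient]) hext'
  have hco := length_le_coheight_of_isAssociatedPrime (M := QuotSMulTop z R) rs hrs
    hreg.toIsWeaklyRegular hP
  have hsum : ((Order.height (⟨P, hP.isPrime⟩ : PrimeSpectrum R) +
      Order.coheight (⟨P, hP.isPrime⟩ : PrimeSpectrum R) : ℕ∞) : WithBot ℕ∞) ≤ ringKrullDim R := by
    rw [ringKrullDim, Order.krullDim_eq_iSup_height_add_coheight_of_nonempty]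
    exact WithBot.coe_le_coe.mpr (le_iSup (fun a : PrimeSpectrum R =>
      Order.height a + Order.coheight a) _)
  rw [hd] at hsum
  have hsum' : Order.height (⟨P, hP.isPrime⟩ : PrimeSpectrum R) +
      Order.coheight (⟨P, hP.isPrime⟩ : PrimeSpectrum R) ≤ (d : ℕ∞) := WithBot.coe_le_coe.mp hsum
  obtain ⟨Q, hQP, hlt⟩ : ∃ Q : PrimeSpectrum R, Q < ⟨P, hP.isPrime⟩ ∧ True := by
    have hPprime := hP.isPrime
    obtain ⟨q, hq, hqP⟩ := Ideal.exists_minimalPrimes_le (I := ⊥) (J := P) bot_le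
    refine ⟨⟨q, hq.1.1⟩, lt_of_le_of_ne hqP fun h => ?_, trivial⟩
    have hzP : z ∈ P := by
      refine hP.annihilator_le ?_
      rw [Submodule.mem_annihilator]
      rintro n -
      obtain ⟨n, rfl⟩ := Submodule.Quotient.mk_surjective _ n
      rw [← Submodule.Quotient.mk_smul, Submodule.Quotient.mk_eq_zero]
      exact Submodule.smul_mem_pointwise_smul _ _ _ trivial
    have : q = P := congrArg PrimeSpectrum.asIdeal h
    subst this
    exact Set.disjoint_left.mp (Ideal.disjoint_nonZeroDivisors_of_mem_minimalPrimes hq) hzP hz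
  have h1 : (1 : ℕ∞) ≤ Order.height (⟨P, hP.isPrime⟩ : PrimeSpectrum R) :=
    le_trans (by simp) (Order.height_add_one_le hQP)
  have hd1 : 1 ≤ d := by
    have : (1 : ℕ∞) ≤ d := h1.trans (le_self_add.trans hsum')
    exact_mod_cast this
  rw [hlen] at hco
  generalize Order.height (⟨P, hP.isPrime⟩ : PrimeSpectrum R) = a at *
  generalize Order.coheight (⟨P, hP.isPrime⟩ : PrimeSpectrum R) = b at *
  have hab : a ≠ ⊤ ∧ b ≠ ⊤ := by
    constructor <;> rintro rfl <;> simp at hsum'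
  lift a to ℕ using hab.1
  lift b to ℕ using hab.2
  norm_cast at *
  omega

end AssociatedPrimes

section Local

open IsLocalRing

lemma exists_maximalIdeal_pow_le_span_singleton {R : Type*} [CommRing R] [IsLocalRing R]
    [IsNoetherianRing R] (hdim : ringKrullDim R = 1) (w : R) (hw : w ∈ nonZeroDivisors R) :
    ∃ c, maximalIdeal R ^ c ≤ Ideal.span {w} := by
  refine Ideal.exists_pow_le_of_le_radical_of_fg ?_ (IsNoetherian.noetherian _)
  rw [Ideal.radical_eq_sInf]
  refine le_sInf ?_
  rintro Q ⟨hQ, hQp⟩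
  by_contra hne
  have hlt : Q < maximalIdeal R := lt_of_le_of_ne (le_maximalIdeal hQp.ne_top)
    fun h => hne h.ge
  have h1 := Ideal.height_add_one_le_of_lt_of_isPrime hlt
  have h2 : (maximalIdeal R).height = 1 := by
    have := maximalIdeal_height_eq_ringKrullDim (R := R)
    rw [hdim] at this
    exact_mod_cast this
  rw [h2] at h1
  have h3 : Q.height = 0 := by
    have hne : Q.height ≠ ⊤ := fun h => by simp [h] at h1
    lift Q.height to ℕ using hne with n
    norm_cast at *
    omega
  exact Set.disjoint_left.mp (Ideal.disjoint_nonZeroDivisors_of_mem_minimalPrimes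
    (Ideal.height_eq_zero_iff.mp h3)) (hQ (Ideal.mem_span_singleton_self w)) hw

lemma mem_mul_dualIdeal {R : Type u} [CommRing R] [IsLocalRing R] [IsNoetherianRing R]
    (hdim : ringKrullDim R = 1)
    (ext : ((Ext R (ModuleCat.{u} R) 1).obj (Opposite.op (ModuleCat.of R (R ⧸ maximalIdeal R)))).obj
      (ModuleCat.of R R) ≅ ModuleCat.of R (R ⧸ maximalIdeal R))
    {e N₀ : ℕ} (he6 : e ≤ 6) (he : ∀ n ≥ N₀, Module.length R (R ⧸ maximalIdeal R ^ (n + 1)) =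
      Module.length R (R ⧸ maximalIdeal R ^ n) + e)
    {z : R} (hzm : z ∈ maximalIdeal R) (hz : z ∈ nonZeroDivisors R) {r : ℕ} {a : Fin r → R}
    {I : Ideal R} (ha : Ideal.span (Set.range a) = I) (hzI : z ∈ I)
    (hs : SyzCond a (dualIdeal z I)) : z ∈ I * dualIdeal z I := by
  have hprim := exists_maximalIdeal_pow_le_span_singleton hdim
  obtain ⟨c, hc⟩ := hprim z hz
  have hdd := dualIdeal_dualIdeal_of_socle (socle_of_ext_one_iso (maximalIdeal.isMaximal R)
    hzm hz ext) hc I hzI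
  exact mem_mul_of_multiplicity_le_six he6 he hprim hzm hz hzI (mem_dualIdeal_self z I)
    (fun x hx y hy => hy x hx) (fun y hy => hy) (fun y hy => hdd ▸ hy) (injective_of_syzCond ha hs)

end Local

section Localization

variable {R : Type*} [CommRing R] {S : Type*} [CommRing S] [Algebra R S]

lemma map_dualIdeal (M : Submonoid R) [IsLocalization M S] {r : ℕ} {a : Fin r → R} {I : Ideal R} (ha : Ideal.span (Set.range a) = I)
    (z : R) :
    (dualIdeal z I).map (algebraMap R S) =
      dualIdeal (algebraMap R S z) (I.map (algebraMap R S)) := by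
  have hsz : Ideal.span {algebraMap R S z} = (Ideal.span {z}).map (algebraMap R S) := by
    rw [Ideal.map_span, Set.image_singleton]
  refine le_antisymm (Ideal.map_le_iff_le_comap.mpr fun y hy => ?_) fun y hy => ?_
  · rw [Ideal.mem_comap, mem_dualIdeal]
    intro x hx
    have : I.map (algebraMap R S) ≤
        (Ideal.span {algebraMap R S z}).colon {algebraMap R S y} := by
      refine Ideal.map_le_iff_le_comap.mpr fun x hx => ?_
      rw [Ideal.mem_comap, Submodule.mem_colon_singleton, smul_eq_mul, ← map_mul, hsz]
      exact Ideal.mem_map_of_mem _ (hy x hx)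
    exact Submodule.mem_colon_singleton.mp (this hx)
  · obtain ⟨⟨y', s⟩, rfl⟩ := IsLocalization.mk'_surjective M y
    have haI : ∀ i, a i ∈ I := fun i => ha ▸ Ideal.subset_span ⟨i, rfl⟩
    have h1 : ∀ i, ∃ t ∈ M, t * (a i * y') ∈ Ideal.span {z} := by
      intro i
      rw [← IsLocalization.algebraMap_mem_map_algebraMap_iff M S, ← hsz, map_mul,
        ← IsLocalization.mk'_spec S y' s, ← mul_assoc]
      exact Ideal.mul_mem_right _ _ (hy _ (Ideal.mem_map_of_mem _ (haI i)))
    choose t htM ht using h1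
    have hmem : (∏ i, t i) * y' ∈ dualIdeal z I := by
      have hle : I ≤ (Ideal.span {z}).colon {(∏ i, t i) * y'} := by
        rw [← ha, Ideal.span_le]
        rintro _ ⟨i, rfl⟩
        rw [SetLike.mem_coe, Submodule.mem_colon_singleton, smul_eq_mul,
          ← Finset.mul_prod_erase _ _ (Finset.mem_univ i)]
        have : a i * (t i * (∏ j ∈ Finset.univ.erase i, t j) * y') =
          (∏ j ∈ Finset.univ.erase i, t j) * (t i * (a i * y')) := by ring
        rw [this]
        exact Ideal.mul_mem_left _ _ (ht i)
      exact fun x hx => Submodule.mem_colon_singleton.mp (hle hx)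
    rw [IsLocalization.mk'_mem_map_algebraMap_iff]
    exact ⟨∏ i, t i, M.prod_mem fun i _ => htM i, hmem⟩

lemma SyzCond.map (M : Submonoid R) [IsLocalization M S] {r : ℕ} {a : Fin r → R} {J : Ideal R} (h : SyzCond a J) :
    SyzCond (fun i => algebraMap R S (a i)) (J.map (algebraMap R S)) := by
  intro g hg hsum
  have h1 : ∀ i, ∃ (x : J) (s : M), g i * algebraMap R S s = algebraMap R S x := fun i => by
    obtain ⟨⟨x, s⟩, hx⟩ := (IsLocalization.mem_map_algebraMap_iff M S).mp (hg i)
    exact ⟨x, s, hx⟩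
  choose x s hx using h1
  let g' : Fin r → R := fun i => (∏ j ∈ Finset.univ.erase i, (s j : R)) * x i
  let t : M := ∏ j, s j
  have htg : ∀ i, algebraMap R S (g' i) = algebraMap R S t * g i := by
    intro i
    simp only [g', map_mul, ← hx]
    rw [Submonoid.coe_finsetProd, ← Finset.mul_prod_erase _ _ (Finset.mem_univ i), map_mul]
    ring
  have hsum' : algebraMap R S (∑ i, a i * g' i) = algebraMap R S 0 := by
    rw [map_zero, map_sum]
    simp only [map_mul, htg]
    calc _ = algebraMap R S t * ∑ i, algebraMap R S (a i) * g i := by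
          rw [Finset.mul_sum]; exact Finset.sum_congr rfl fun i _ => by ring
      _ = 0 := by rw [hsum, mul_zero]
  obtain ⟨u, hu⟩ := (IsLocalization.eq_iff_exists M S).mp hsum'
  obtain ⟨k, p, q, hq, hgp, hpa⟩ := h (fun i => u * g' i)
    (fun i => J.mul_mem_left _ (J.mul_mem_left _ (x i).2)) (by
      rw [mul_zero, Finset.mul_sum] at hu
      rw [← hu]
      exact Finset.sum_congr rfl fun i _ => by ring)
  obtain ⟨v, hv⟩ := (IsLocalization.map_units S (u * t)).exists_left_inv
  refine ⟨k, fun i κ => v * algebraMap R S (p i κ), fun κ => algebraMap R S (q κ),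
    fun κ => Ideal.mem_map_of_mem _ (hq κ), fun i => ?_, fun κ => ?_⟩
  · have := congrArg (algebraMap R S) (hgp i)
    rw [map_mul, htg, map_sum] at this
    simp only [map_mul] at this
    rw [Submonoid.coe_mul, map_mul] at hv
    calc g i = v * (algebraMap R S u * (algebraMap R S t * g i)) := by
          rw [← mul_assoc (algebraMap R S u), ← mul_assoc, hv, one_mul]
      _ = _ := by
          rw [this, Finset.mul_sum]; exact Finset.sum_congr rfl fun κ _ => by ring
  · have := congrArg (algebraMap R S) (hpa κ)
    rw [map_zero, map_sum] at this
    simp only [map_mul] at this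
    calc _ = v * ∑ i, algebraMap R S (p i κ) * algebraMap R S (a i) := by
          rw [Finset.mul_sum]; exact Finset.sum_congr rfl fun i _ => by ring
      _ = 0 := by rw [this, mul_zero]

end Localization

section Evaluation

variable {R : Type*} [CommRing R] {z : R} {I : Ideal R}

lemma exists_mul_linearMap_eq (hz : z ∈ nonZeroDivisors R) {N : Type*} [AddCommGroup N]
    [Module R N] (L : N →ₗ[R] R) (hL : ∀ n, L n ∈ Ideal.span {z}) :
    ∃ L' : N →ₗ[R] R, ∀ n, z * L' n = L n := by
  have hinj : Function.Injective (LinearMap.mulLeft R z) := fun a b h => by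
    have h' : z * (a - b) = 0 := by rw [mul_sub]; exact sub_eq_zero.mpr h
    exact sub_eq_zero.mp ((mul_left_mem_nonZeroDivisors_eq_zero_iff hz).mp h')
  let e := LinearEquiv.ofInjective _ hinj
  refine ⟨e.symm.toLinearMap ∘ₗ L.codRestrict (LinearMap.range (LinearMap.mulLeft R z)) fun n => ?_,
    fun n => ?_⟩
  · obtain ⟨a, ha⟩ := Ideal.mem_span_singleton'.mp (hL n)
    exact ⟨a, by rw [LinearMap.mulLeft_apply, mul_comm, ha]⟩
  · exact congrArg Subtype.val (e.apply_symm_apply ⟨L n, _⟩)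

lemma mul_apply_comm (g : I →ₗ[R] R) (x y : I) : (x : R) * g y = y * g x := by
  rw [← smul_eq_mul, ← smul_eq_mul, ← map_smul, ← map_smul]
  congr 1
  ext
  simp [mul_comm]

lemma evalMap_tmul (x : I) (g : I →ₗ[R] R) : evalMap R I R (x ⊗ₜ g) = g x := rfl

lemma mul_functional_eq (hz : z ∈ nonZeroDivisors R) (hzI : z ∈ I)
    (f : (I ⊗[R] (I →ₗ[R] R)) →ₗ[R] R) (m : I ⊗[R] (I →ₗ[R] R)) :
    z * f m = f ((⟨z, hzI⟩ : I) ⊗ₜ I.subtype) * evalMap R I R m := by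
  induction m using TensorProduct.induction_on with
  | zero => simp
  | add a b ha hb => rw [map_add, map_add, mul_add, mul_add, ha, hb]
  | tmul x g =>
    rw [evalMap_tmul]
    have h1 : z • (x ⊗ₜ[R] g) = (x : R) • ((⟨z, hzI⟩ : I) ⊗ₜ[R] g) := by
      rw [TensorProduct.smul_tmul', TensorProduct.smul_tmul']
      congr 1
      ext
      simp [mul_comm]
    have h2 : z • g = g ⟨z, hzI⟩ • I.subtype := by
      ext y
      have := mul_apply_comm g ⟨z, hzI⟩ y
      simp only [LinearMap.smul_apply, smul_eq_mul, Submodule.subtype_apply] at this ⊢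
      rw [this, mul_comm]
    have h3 : z • ((⟨z, hzI⟩ : I) ⊗ₜ[R] g) = g ⟨z, hzI⟩ • ((⟨z, hzI⟩ : I) ⊗ₜ[R] I.subtype) := by
      rw [← TensorProduct.tmul_smul, h2, TensorProduct.tmul_smul]
    have h4 : z * f (x ⊗ₜ g) = x * f ((⟨z, hzI⟩ : I) ⊗ₜ[R] g) := by
      have := congrArg f h1
      rwa [map_smul, map_smul] at this
    have h5 : z * f ((⟨z, hzI⟩ : I) ⊗ₜ[R] g) =
        g ⟨z, hzI⟩ * f ((⟨z, hzI⟩ : I) ⊗ₜ[R] I.subtype) := by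
      have := congrArg f h3
      rwa [map_smul, map_smul] at this
    have h6 := mul_apply_comm g ⟨z, hzI⟩ x
    rw [← sub_eq_zero]
    refine (mul_left_mem_nonZeroDivisors_eq_zero_iff hz).mp ?_
    linear_combination z * h4 + x * h5 - f ((⟨z, hzI⟩ : I) ⊗ₜ[R] I.subtype) * h6

lemma injective_evalMap (hz : z ∈ nonZeroDivisors R) (hzI : z ∈ I)
    (hrefl : Module.IsReflexive R (I ⊗[R] (I →ₗ[R] R))) :
    Function.Injective (evalMap R I R) := by
  rw [injective_iff_map_eq_zero]
  intro m hm
  refine hrefl.bijective_dual_eval'.1 ?_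
  rw [map_zero]
  ext f
  have := mul_functional_eq hz hzI f m
  rw [hm, mul_zero] at this
  exact (mul_left_mem_nonZeroDivisors_eq_zero_iff hz).mp this

lemma exists_apply_eq_of_mem_dualIdeal (hz : z ∈ nonZeroDivisors R) {y : R}
    (hy : y ∈ dualIdeal z I) : ∃ g : I →ₗ[R] R, ∀ x : I, z * g x = x * y := by
  obtain ⟨g, hg⟩ := exists_mul_linearMap_eq hz (y • I.subtype) (fun x => by
    have := hy x x.2
    rw [mul_comm] at this
    exact this)
  exact ⟨g, fun x => (hg x).trans (mul_comm y x)⟩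

lemma injective_mulMap_dualIdeal (hz : z ∈ nonZeroDivisors R) (hzI : z ∈ I)
    (hinj : Function.Injective (evalMap R I R)) :
    Function.Injective (Submodule.mulMap I (dualIdeal z I)) := by
  let φ₀ : (I →ₗ[R] R) →ₗ[R] dualIdeal z I :=
    (LinearMap.applyₗ (⟨z, hzI⟩ : I)).codRestrict (dualIdeal z I) fun g x hx => by
      have := mul_apply_comm g ⟨x, hx⟩ ⟨z, hzI⟩
      exact this ▸ Ideal.mul_mem_right _ _ (Ideal.mem_span_singleton_self z)
  have hφ : Function.Bijective φ₀ := by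
    constructor
    · rw [injective_iff_map_eq_zero]
      intro g hg
      have hg' : g ⟨z, hzI⟩ = 0 := congrArg Subtype.val hg
      ext x
      have := mul_apply_comm g ⟨z, hzI⟩ x
      rw [hg', mul_zero] at this
      exact (mul_left_mem_nonZeroDivisors_eq_zero_iff hz).mp this
    · rintro ⟨y, hy⟩
      obtain ⟨g, hg⟩ := exists_apply_eq_of_mem_dualIdeal hz hy
      refine ⟨g, Subtype.ext ?_⟩
      have h : z * (g ⟨z, hzI⟩ - y) = 0 := by rw [mul_sub, hg ⟨z, hzI⟩, sub_self]
      exact sub_eq_zero.mp ((mul_left_mem_nonZeroDivisors_eq_zero_iff hz).mp h)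
  let φ := LinearEquiv.ofBijective φ₀ hφ
  have hcomp : ∀ m, Submodule.mulMap I (dualIdeal z I) (φ.lTensor I m) = z * evalMap R I R m := by
    intro m
    induction m using TensorProduct.induction_on with
    | zero => simp
    | add a b ha hb => rw [map_add, map_add, map_add, mul_add, ha, hb]
    | tmul x g =>
      rw [LinearEquiv.lTensor_tmul, Submodule.mulMap_tmul, evalMap_tmul]
      exact mul_apply_comm g x ⟨z, hzI⟩
  rw [injective_iff_map_eq_zero]
  intro n hn
  obtain ⟨m, rfl⟩ := (φ.lTensor I).surjective n
  rw [hcomp] at hn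
  rw [hinj (a₁ := m) (a₂ := 0) (by
    rw [map_zero]; exact (mul_left_mem_nonZeroDivisors_eq_zero_iff hz).mp hn), map_zero]

lemma mem_range_evalMap_of_mul_mem (hz : z ∈ nonZeroDivisors R) {t : R}
    (ht : t * z ∈ I * dualIdeal z I) : t ∈ LinearMap.range (evalMap R I R) := by
  have hle : ∀ y ∈ I * dualIdeal z I, ∃ m, y = z * evalMap R I R m := by
    intro y hy
    refine Submodule.mul_induction_on hy (fun x hx y hy => ?_) ?_
    · obtain ⟨g, hg⟩ := exists_apply_eq_of_mem_dualIdeal hz hy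
      exact ⟨(⟨x, hx⟩ : I) ⊗ₜ g, (hg ⟨x, hx⟩).symm⟩
    · rintro _ _ ⟨m, rfl⟩ ⟨n, rfl⟩
      exact ⟨m + n, by rw [map_add, mul_add]⟩
  obtain ⟨m, hm⟩ := hle _ ht
  refine ⟨m, ?_⟩
  have h : z * (evalMap R I R m - t) = 0 := by rw [mul_sub, ← hm]; ring
  exact sub_eq_zero.mp ((mul_left_mem_nonZeroDivisors_eq_zero_iff hz).mp h)

lemma one_mem_range_evalMap (hz : z ∈ nonZeroDivisors R) (hzI : z ∈ I)
    (hrefl : Module.IsReflexive R (I ⊗[R] (I →ₗ[R] R))) {b : R}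
    (hb : b ∈ LinearMap.range (evalMap R I R)) (hbz : IsSMulRegular (QuotSMulTop z R) b) :
    1 ∈ LinearMap.range (evalMap R I R) := by
  obtain ⟨m', rfl⟩ := hb
  let m₀ : I ⊗[R] (I →ₗ[R] R) := (⟨z, hzI⟩ : I) ⊗ₜ I.subtype
  obtain ⟨φ, hφ⟩ := exists_mul_linearMap_eq hz (Module.Dual.eval R _ m₀) (fun f => by
    have h1 := mul_functional_eq hz hzI f m'
    have h2 : (Submodule.Quotient.mk (f m₀) : QuotSMulTop z R) = 0 := by
      refine hbz ?_
      change evalMap R I R m' • _ = evalMap R I R m' • 0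
      rw [smul_zero, ← Submodule.Quotient.mk_smul, Submodule.Quotient.mk_eq_zero, smul_eq_mul,
        mul_comm, ← h1]
      exact Submodule.smul_mem_pointwise_smul _ _ _ trivial
    rw [Submodule.Quotient.mk_eq_zero] at h2
    obtain ⟨r, -, hr⟩ := (Submodule.mem_smul_pointwise_iff_exists _ _ _).mp h2
    exact Ideal.mem_span_singleton'.mpr ⟨r, by rw [mul_comm]; exact hr⟩)
  obtain ⟨m, rfl⟩ := hrefl.bijective_dual_eval'.2 φ
  refine ⟨m, ?_⟩
  have h1 : z * evalMap R I R m = z := hφ (evalMap R I R)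
  have h : z * (evalMap R I R m - 1) = 0 := by rw [mul_sub, h1, mul_one, sub_self]
  exact sub_eq_zero.mp ((mul_left_mem_nonZeroDivisors_eq_zero_iff hz).mp h)

lemma exists_eq_span_singleton_of_one_mem_range_evalMap [IsLocalRing R]
    (h : 1 ∈ LinearMap.range (evalMap R I R)) : ∃ x : R, I = Ideal.span {x} := by
  obtain ⟨m, hm⟩ := h
  by_cases hu : ∃ (x : I) (g : I →ₗ[R] R), IsUnit (g x)
  · obtain ⟨x, g, u, hu⟩ := hu
    refine ⟨x, le_antisymm (fun y hy => ?_) ((Ideal.span_singleton_le_iff_mem _).mpr x.2)⟩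
    refine Ideal.mem_span_singleton'.mpr ⟨↑u⁻¹ * g ⟨y, hy⟩, ?_⟩
    have h1 := mul_apply_comm g x ⟨y, hy⟩
    rw [← hu] at h1
    have h2 : (↑u⁻¹ : R) * u = 1 := u.inv_mul
    linear_combination (↑u⁻¹ : R) * h1 + y * h2
  · exfalso
    have hmem : ∀ m, evalMap R I R m ∈ IsLocalRing.maximalIdeal R := by
      intro m
      induction m using TensorProduct.induction_on with
      | zero => simp
      | add a b ha hb => rw [map_add]; exact Ideal.add_mem _ ha hb
      | tmul x g => exact fun h => hu ⟨x, g, h⟩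
    exact (IsLocalRing.maximalIdeal.isMaximal R).ne_top
      ((Ideal.eq_top_iff_one _).mpr (hm ▸ hmem m))

lemma exists_mem_isSMulRegular [IsNoetherianRing R] {M : Type*} [AddCommGroup M] [Module R M]
    [Module.Finite R M] (h : ∀ P, IsAssociatedPrime P M → ¬ I ≤ P) : ∃ b ∈ I, IsSMulRegular M b := by
  have h : Subsingleton ((R ⧸ I) →ₗ[R] M) := by
    refine ⟨fun f g => ?_⟩
    have key : ∀ f : (R ⧸ I) →ₗ[R] M, f (I.mkQ 1) = 0 := by
      intro f
      by_contra hne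
      obtain ⟨P, hP, hle⟩ := exists_le_isAssociatedPrime_of_isNoetherianRing R _ hne
      refine h P hP fun x hx => hle ?_
      rw [Submodule.mem_colon_singleton, Submodule.mem_bot, ← map_smul, ← map_smul, smul_eq_mul,
        mul_one, show I.mkQ (x : R) = 0 from (Submodule.Quotient.mk_eq_zero _).mpr hx, map_zero]
    apply Submodule.linearMap_qext
    ext
    exact (key f).trans (key g).symm
  obtain ⟨z, hz, hreg⟩ := IsSMulRegular.subsingleton_linearMap_iff.mp h
  rw [Ideal.annihilator_quotient] at hz
  exact ⟨z, hz, hreg⟩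

lemma exists_mem_nonZeroDivisors_of_annihilator_eq_bot [IsNoetherianRing R]
    (hfaith : Module.annihilator R I = ⊥) : ∃ z ∈ I, z ∈ nonZeroDivisors R := by
  obtain ⟨z, hzI, hz⟩ := exists_mem_isSMulRegular (I := I) (M := R) fun P hP hle => by
    obtain ⟨hPp, y, hy⟩ := isAssociatedPrime_iff.mp hP
    have hPy : ∀ p, p ∈ P ↔ p * y = 0 := fun p => by
      rw [hy, Submodule.mem_colon_singleton, Submodule.mem_bot, smul_eq_mul]
    have hy0 : y ∈ Module.annihilator R I := by
      rw [Module.mem_annihilator]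
      intro x
      ext
      simpa [mul_comm] using (hPy x).mp (hle x.2)
    rw [hfaith, Submodule.mem_bot] at hy0
    exact hPp.ne_top ((Ideal.eq_top_iff_one _).mpr ((hPy 1).mpr (by rw [hy0, mul_zero])))
  refine ⟨z, hzI, mem_nonZeroDivisors_iff_left.mpr fun x hx => hz ?_⟩
  simpa using hx

end Evaluation

lemma exists_notMem_mul_mem_mul_dualIdeal {R : Type u} [CommRing R] [IsNoetherianRing R]
    {p : Ideal R} (hp : p.IsPrime) (hheight : Order.height (⟨p, hp⟩ : PrimeSpectrum R) = 1)
    (hcan : IsCanonicalModuleAt (Localization.AtPrime p)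
      (IsLocalRing.maximalIdeal (Localization.AtPrime p)) (Localization.AtPrime p))
    {e : ℕ} (hmult : IsMultiplicityAt (Localization.AtPrime p)
      (IsLocalRing.maximalIdeal (Localization.AtPrime p)) e) (he : e ≤ 6)
    {z : R} (hzp : z ∈ p) (hz : z ∈ nonZeroDivisors R) {I : Ideal R} (hzI : z ∈ I)
    (hinj : Function.Injective (Submodule.mulMap I (dualIdeal z I))) :
    ∃ t ∉ p, t * z ∈ I * dualIdeal z I := by
  let S := Localization.AtPrime p
  have hdim : ringKrullDim S = 1 := by
    rw [IsLocalization.AtPrime.ringKrullDim_eq_height p S]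
    have := PrimeSpectrum.height_eq_orderHeight (⟨p, hp⟩ : PrimeSpectrum R)
    rw [hheight] at this
    exact congrArg _ this
  obtain ⟨-, -, ⟨iso⟩⟩ := hcan
  obtain ⟨N, hN⟩ := hmult
  obtain ⟨r, a, ha⟩ := Submodule.fg_iff_exists_fin_generating_family.mp
    (IsNoetherian.noetherian I)
  change Ideal.span (Set.range a) = I at ha
  have hs : SyzCond (fun i => algebraMap R S (a i))
      (dualIdeal (algebraMap R S z) (I.map (algebraMap R S))) := by
    rw [← map_dualIdeal p.primeCompl ha]
    exact (syzCond_of_injective hinj ha).map p.primeCompl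
  have hmem := mem_mul_dualIdeal hdim iso he
    (fun n hn => by simpa only [moduleLength, Module.length_eq_height] using hN n hn)
    ((IsLocalization.AtPrime.to_map_mem_maximal_iff S p z).mpr hzp)
    (IsLocalization.map_nonZeroDivisors_le p.primeCompl S ⟨z, hz, rfl⟩)
    (I := I.map (algebraMap R S))
    (by rw [← ha, Ideal.map_span, ← Set.range_comp]; rfl) (Ideal.mem_map_of_mem _ hzI) hs
  rw [← map_dualIdeal p.primeCompl ha, ← Ideal.map_mul,
    IsLocalization.algebraMap_mem_map_algebraMap_iff p.primeCompl] at hmem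
  exact hmem

/-- (Corollary 1.5) Let `R` be a Cohen–Macaulay local ring with
`dim R ≥ 1` such that for every height one prime `p` the localization `R_p` is Gorenstein
with `e(R_p) ≤ 6`. If `I` is a faithful ideal such that `I ⊗_R Hom_R(I, R)` is reflexive,
then `I` is principal. -/
theorem stmt6 (R : Type u) [CommRing R] [IsLocalRing R] (hNoeth : IsNoetherianRing R)
    (hCM : IsCMLocal R) (hdim : 1 ≤ ringKrullDim R)
    (hp : ∀ (p : Ideal R) (hp : p.IsPrime),
      Order.height (⟨p, hp⟩ : PrimeSpectrum R) = 1 →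
        IsCanonicalModuleAt (Localization.AtPrime p)
            (IsLocalRing.maximalIdeal (Localization.AtPrime p)) (Localization.AtPrime p) ∧
          ∃ e : ℕ, IsMultiplicityAt (Localization.AtPrime p)
              (IsLocalRing.maximalIdeal (Localization.AtPrime p)) e ∧ e ≤ 6)
    (I : Ideal R) (hfaith : Module.annihilator R ↥I = ⊥)
    (hrefl : Module.IsReflexive R (↥I ⊗[R] (↥I →ₗ[R] R))) :
    ∃ x : R, I = Ideal.span {x} := by
  obtain ⟨d, hd, hext⟩ := hCM
  obtain ⟨z, hzI, hz⟩ := exists_mem_nonZeroDivisors_of_annihilator_eq_bot hfaith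
  have hinj := injective_mulMap_dualIdeal hz hzI (injective_evalMap hz hzI hrefl)
  obtain ⟨b, hb, hbz⟩ := exists_mem_isSMulRegular (I := LinearMap.range (evalMap R I R))
    (M := QuotSMulTop z R) fun P hP hle => by
    have hheight := height_eq_one_of_isAssociatedPrime_quotSMulTop hd hext hz hP
    obtain ⟨hcan, e, hmult, he⟩ := hp P hP.isPrime hheight
    have hzP : z ∈ P := hle ⟨(⟨z, hzI⟩ : I) ⊗ₜ I.subtype, rfl⟩
    obtain ⟨t, htP, ht⟩ := exists_notMem_mul_mem_mul_dualIdeal hP.isPrime hheight hcan hmult he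
      hzP hz hzI hinj
    exact htP (hle (mem_range_evalMap_of_mul_mem hz ht))
  exact exists_eq_span_singleton_of_one_mem_range_evalMap
    (one_mem_range_evalMap hz hzI hrefl hb hbz)

end
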